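/- Assume the limiting system (ODE-Λ) has a solution (Λ₁, Λ₂) on [0, T], (S, r) solves (ODE-Sr), and define Θ, Θ₁, Θ₂, Z₀ = −B₀(Θ + Θ₁), Z₁ = A + G − B(Θ + Θ₁). Let (Λ̌₁^N, Λ̌₂^N, Λ̌₁₂^N, Λ̌₂₂^N, Š₁^N, Š₂^N) be the unique solution on [0,T] of the linear system (ODE-Λ̌₁^N), (ODE-Λ̌₂^N), (ODE-Λ̌₁₂^N), (ODE-Λ̌₂₂^N), (ODE-Š₁^N), (ODE-Š₂^N), and for N large let (Λ₁^N, Λ₂^N) solve (ODE-Λ^N) and (S^N, r^N) solve (ODE-S^N r^N). Then there exist N₁ ≥ 1 and C > 0 such that for all N ≥ N₁, sup_{t∈[0,T]} |S^N(t) − Š₁^N(t) − Š₂^N(t)| ≤ C/N (|·| the Euclidean norm on ℝ^n). -/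

import Mathlib

open Matrix Set

namespace LQ

/-- Frobenius norm of a real matrix. -/
noncomputable def frob {a b : Type*} [Fintype a] [Fintype b] (M : Matrix a b ℝ) : ℝ :=
  Real.sqrt (∑ i, ∑ j, (M i j) ^ 2)

/-- Entrywise ℓ₁ norm of a real matrix. -/
noncomputable def l1norm {a b : Type*} [Fintype a] [Fintype b] (M : Matrix a b ℝ) : ℝ :=
  ∑ i, ∑ j, |M i j|

/-- Block matrix with all diagonal m×m blocks equal to `F` and all off-diagonal blocks equal to `K`. -/
def blockConst (N m : ℕ) (F K : Matrix (Fin m) (Fin m) ℝ) :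
    Matrix (Fin N × Fin m) (Fin N × Fin m) ℝ :=
  Matrix.of fun x y => if x.1 = y.1 then F x.2 y.2 else K x.2 y.2

/-- Block matrix with diagonal blocks `Λ₁` and off-diagonal blocks `Λ₂ / N`. -/
noncomputable def blockPN (N n : ℕ) (Λ₁ Λ₂ : Matrix (Fin n) (Fin n) ℝ) :
    Matrix (Fin N × Fin n) (Fin N × Fin n) ℝ :=
  Matrix.of fun x y => if x.1 = y.1 then Λ₁ x.2 y.2 else Λ₂ x.2 y.2 / (N : ℝ)

/-- The permutation matrix exchanging the i-th and j-th block rows of `I_{Nn}`. -/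
def Jswap (N n : ℕ) (i j : Fin N) : Matrix (Fin N × Fin n) (Fin N × Fin n) ℝ :=
  Matrix.of fun x y => if y.1 = Equiv.swap i j x.1 ∧ y.2 = x.2 then 1 else 0

/-- `I_N ⊗ M`. -/
def kronIN (N : ℕ) {a b : ℕ} (M : Matrix (Fin a) (Fin b) ℝ) :
    Matrix (Fin N × Fin a) (Fin N × Fin b) ℝ :=
  Matrix.of fun x y => if x.1 = y.1 then M x.2 y.2 else 0

/-- `𝟏_{N×1} ⊗ M`. -/
def stackN (N : ℕ) {a b : ℕ} (M : Matrix (Fin a) (Fin b) ℝ) :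
    Matrix (Fin N × Fin a) (Fin b) ℝ :=
  Matrix.of fun x y => M x.2 y

/-- Data of the LQ mean field social optimization problem. -/
structure Params (n n₁ : ℕ) where
  A : Matrix (Fin n) (Fin n) ℝ
  G : Matrix (Fin n) (Fin n) ℝ
  Γ : Matrix (Fin n) (Fin n) ℝ
  Γf : Matrix (Fin n) (Fin n) ℝ
  B : Matrix (Fin n) (Fin n₁) ℝ
  B0 : Matrix (Fin n) (Fin n₁) ℝ
  B1 : Matrix (Fin n) (Fin n₁) ℝ
  D : Matrix (Fin n) (Fin 1) ℝ
  D0 : Matrix (Fin n) (Fin 1) ℝ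
  Q : Matrix (Fin n) (Fin n) ℝ
  Qf : Matrix (Fin n) (Fin n) ℝ
  R : Matrix (Fin n₁) (Fin n₁) ℝ
  T : ℝ

namespace Params

variable {n n₁ : ℕ} (p : Params n n₁)

/-- Standing hypotheses: positive dimensions, positive horizon, symmetric weights. -/
def Standing : Prop :=
  1 ≤ n ∧ 1 ≤ n₁ ∧ 0 < p.T ∧ p.Q.IsSymm ∧ p.Qf.IsSymm ∧ p.R.IsSymm

/-- Q^Γ = Γᵀ Q Γ − Q Γ − Γᵀ Q. -/
def QΓ : Matrix (Fin n) (Fin n) ℝ := p.Γᵀ * p.Q * p.Γ - p.Q * p.Γ - p.Γᵀ * p.Q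

/-- Q_f^Γ = Γ_fᵀ Q_f Γ_f − Q_f Γ_f − Γ_fᵀ Q_f. -/
def QfΓ : Matrix (Fin n) (Fin n) ℝ := p.Γfᵀ * p.Qf * p.Γf - p.Qf * p.Γf - p.Γfᵀ * p.Qf

/-- ℛ₁(Λ₁) = R + B₁ᵀ Λ₁ B₁. -/
def R1 (Λ₁ : Matrix (Fin n) (Fin n) ℝ) : Matrix (Fin n₁) (Fin n₁) ℝ :=
  p.R + p.B1ᵀ * Λ₁ * p.B1

/-- ℛ₂(Λ₁,Λ₂) = R + B₁ᵀ Λ₁ B₁ + B₀ᵀ(Λ₁+Λ₂)B₀. -/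
def R2 (Λ₁ Λ₂ : Matrix (Fin n) (Fin n) ℝ) : Matrix (Fin n₁) (Fin n₁) ℝ :=
  p.R + p.B1ᵀ * Λ₁ * p.B1 + p.B0ᵀ * (Λ₁ + Λ₂) * p.B0

/-- Ψ₁. -/
noncomputable def Ψ₁ (Λ₁ : Matrix (Fin n) (Fin n) ℝ) : Matrix (Fin n) (Fin n) ℝ :=
  Λ₁ * p.B * (p.R1 Λ₁)⁻¹ * p.Bᵀ * Λ₁ - Λ₁ * p.A - p.Aᵀ * Λ₁ - p.Q

/-- Ψ₂. -/
noncomputable def Ψ₂ (Λ₁ Λ₂ : Matrix (Fin n) (Fin n) ℝ) : Matrix (Fin n) (Fin n) ℝ :=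
  (Λ₁ + Λ₂) * p.B * (p.R2 Λ₁ Λ₂)⁻¹ * p.Bᵀ * (Λ₁ + Λ₂)
    - Λ₁ * p.B * (p.R1 Λ₁)⁻¹ * p.Bᵀ * Λ₁
    - (Λ₁ * p.G + Λ₂ * (p.A + p.G))
    - (p.Gᵀ * Λ₁ + (p.Aᵀ + p.Gᵀ) * Λ₂)
    - p.QΓ

/-- Solution of the limiting ODE system (ODE-Λ) on [0,T]. -/
noncomputable def IsSolLim (Λ₁ Λ₂ : ℝ → Matrix (Fin n) (Fin n) ℝ) : Prop :=
  (∀ t ∈ Icc (0 : ℝ) p.T, (Λ₁ t).IsSymm ∧ (Λ₂ t).IsSymm) ∧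
  (∀ t ∈ Icc (0 : ℝ) p.T, (p.R1 (Λ₁ t)).PosDef ∧ (p.R2 (Λ₁ t) (Λ₂ t)).PosDef) ∧
  Λ₁ p.T = p.Qf ∧ Λ₂ p.T = p.QfΓ ∧
  (∀ t ∈ Icc (0 : ℝ) p.T, ∀ i j, HasDerivWithinAt (fun s => Λ₁ s i j)
    (p.Ψ₁ (Λ₁ t) i j) (Icc (0 : ℝ) p.T) t) ∧
  (∀ t ∈ Icc (0 : ℝ) p.T, ∀ i j, HasDerivWithinAt (fun s => Λ₂ s i j)
    (p.Ψ₂ (Λ₁ t) (Λ₂ t) i j) (Icc (0 : ℝ) p.T) t)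

/-! Big (N-agent) matrices. -/

noncomputable def bigA (N : ℕ) : Matrix (Fin N × Fin n) (Fin N × Fin n) ℝ :=
  Matrix.of fun x y => (if x.1 = y.1 then p.A x.2 y.2 else 0) + p.G x.2 y.2 / (N : ℝ)

def bigBhat (N : ℕ) : Matrix (Fin N × Fin n) (Fin N × Fin n₁) ℝ :=
  Matrix.of fun x y => if x.1 = y.1 then p.B x.2 y.2 else 0

def bigB (N : ℕ) (i : Fin N) : Matrix (Fin N × Fin n) (Fin n₁) ℝ :=
  Matrix.of fun x l => if x.1 = i then p.B1 x.2 l else 0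

noncomputable def bigB0 (N : ℕ) : Matrix (Fin N × Fin n) (Fin n₁) ℝ :=
  Matrix.of fun x l => p.B0 x.2 l / (N : ℝ)

def bigD (N : ℕ) (i : Fin N) : Matrix (Fin N × Fin n) (Fin 1) ℝ :=
  Matrix.of fun x l => if x.1 = i then p.D x.2 l else 0

def bigD0 (N : ℕ) : Matrix (Fin N × Fin n) (Fin 1) ℝ :=
  Matrix.of fun x l => p.D0 x.2 l

def bigE (_p : Params n n₁) (N : ℕ) (i : Fin N) : Matrix (Fin n₁) (Fin N × Fin n₁) ℝ :=
  Matrix.of fun k y => if y.1 = i ∧ y.2 = k then 1 else 0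

def bigIhat (_p : Params n n₁) (N : ℕ) : Matrix (Fin n₁) (Fin N × Fin n₁) ℝ :=
  Matrix.of fun k y => if y.2 = k then 1 else 0

noncomputable def bigQ (N : ℕ) : Matrix (Fin N × Fin n) (Fin N × Fin n) ℝ :=
  Matrix.of fun x y => (if x.1 = y.1 then p.Q x.2 y.2 else 0) + p.QΓ x.2 y.2 / (N : ℝ)

noncomputable def bigQf (N : ℕ) : Matrix (Fin N × Fin n) (Fin N × Fin n) ℝ :=
  Matrix.of fun x y => (if x.1 = y.1 then p.Qf x.2 y.2 else 0) + p.QfΓ x.2 y.2 / (N : ℝ)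

def bigR (N : ℕ) : Matrix (Fin N × Fin n₁) (Fin N × Fin n₁) ℝ :=
  Matrix.of fun x y => if x.1 = y.1 then p.R x.2 y.2 else 0

/-- 𝓜₀. -/
noncomputable def M0 (N : ℕ) (Z : Matrix (Fin N × Fin n) (Fin N × Fin n) ℝ) :
    Matrix (Fin 1) (Fin 1) ℝ :=
  (1 / 2 : ℝ) • (∑ i : Fin N, (p.bigD N i)ᵀ * Z * p.bigD N i)
    + (1 / 2 : ℝ) • ((p.bigD0 N)ᵀ * Z * p.bigD0 N)

/-- 𝓜₁. -/
noncomputable def M1 (N : ℕ) (Z : Matrix (Fin N × Fin n) (Fin N × Fin n) ℝ) :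
    Matrix (Fin 1) (Fin N × Fin n₁) ℝ :=
  (∑ i : Fin N, (p.bigD N i)ᵀ * Z * p.bigB N i * p.bigE N i)
    + (p.bigD0 N)ᵀ * Z * p.bigB0 N * p.bigIhat N

/-- 𝓜₂. -/
noncomputable def M2 (N : ℕ) (Z : Matrix (Fin N × Fin n) (Fin N × Fin n) ℝ) :
    Matrix (Fin N × Fin n₁) (Fin N × Fin n₁) ℝ :=
  (1 / 2 : ℝ) • (∑ i : Fin N, (p.bigE N i)ᵀ * (p.bigB N i)ᵀ * Z * p.bigB N i * p.bigE N i)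
    + (1 / 2 : ℝ) • ((p.bigIhat N)ᵀ * (p.bigB0 N)ᵀ * Z * p.bigB0 N * p.bigIhat N)

/-- Right-hand side of the Riccati equation (ODE-P). -/
noncomputable def PRic (N : ℕ) (P : Matrix (Fin N × Fin n) (Fin N × Fin n) ℝ) :
    Matrix (Fin N × Fin n) (Fin N × Fin n) ℝ :=
  P * p.bigBhat N * (p.bigR N + (2 : ℝ) • p.M2 N P)⁻¹ * (p.bigBhat N)ᵀ * P
    - P * p.bigA N - (p.bigA N)ᵀ * P - p.bigQ N

/-- Solution of the large-scale Riccati equation (ODE-P) on [0,T]. -/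
noncomputable def IsSolP (N : ℕ) (P : ℝ → Matrix (Fin N × Fin n) (Fin N × Fin n) ℝ) : Prop :=
  (∀ t ∈ Icc (0 : ℝ) p.T, (P t).IsSymm) ∧
  (∀ t ∈ Icc (0 : ℝ) p.T, (p.bigR N + (2 : ℝ) • p.M2 N (P t)).PosDef) ∧
  P p.T = p.bigQf N ∧
  (∀ t ∈ Icc (0 : ℝ) p.T, ∀ x y, HasDerivWithinAt (fun s => P s x y)
    (p.PRic N (P t) x y) (Icc (0 : ℝ) p.T) t)

/-- Solution of the companion linear equation (ODE-S) on [0,T], relative to `P`. -/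
noncomputable def IsSolS (N : ℕ) (P : ℝ → Matrix (Fin N × Fin n) (Fin N × Fin n) ℝ)
    (S : ℝ → Matrix (Fin N × Fin n) (Fin 1) ℝ) : Prop :=
  S p.T = 0 ∧
  (∀ t ∈ Icc (0 : ℝ) p.T, ∀ x y, HasDerivWithinAt (fun s => S s x y)
    ((P t * p.bigBhat N * (p.bigR N + (2 : ℝ) • p.M2 N (P t))⁻¹ *
        ((p.bigBhat N)ᵀ * S t + (p.M1 N (P t))ᵀ) - (p.bigA N)ᵀ * S t) x y)
    (Icc (0 : ℝ) p.T) t)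

/-- Solution of the companion scalar equation (ODE-r) on [0,T], relative to `P` and `S`. -/
noncomputable def IsSolr (N : ℕ) (P : ℝ → Matrix (Fin N × Fin n) (Fin N × Fin n) ℝ)
    (S : ℝ → Matrix (Fin N × Fin n) (Fin 1) ℝ) (r : ℝ → ℝ) : Prop :=
  r p.T = 0 ∧
  (∀ t ∈ Icc (0 : ℝ) p.T, HasDerivWithinAt r
    (((((S t)ᵀ * p.bigBhat N + p.M1 N (P t)) * (p.bigR N + (2 : ℝ) • p.M2 N (P t))⁻¹ *
        ((p.bigBhat N)ᵀ * S t + (p.M1 N (P t))ᵀ)) - (2 : ℝ) • p.M0 N (P t)) 0 0)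
    (Icc (0 : ℝ) p.T) t)

/-- Asymptotic solvability of the LQ mean field social optimization problem. -/
noncomputable def AsympSolvable : Prop :=
  ∃ N₀ : ℕ, 1 ≤ N₀ ∧ ∃ c₀ : ℝ, 0 < c₀ ∧ ∃ C : ℝ,
    ∀ N : ℕ, N₀ ≤ N →
      ∃ P : ℝ → Matrix (Fin N × Fin n) (Fin N × Fin n) ℝ,
        p.IsSolP N P ∧
        (∀ t ∈ Icc (0 : ℝ) p.T, l1norm (P t) / (N : ℝ) ≤ C) ∧
        (∀ t ∈ Icc (0 : ℝ) p.T,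
          (p.bigR N + (2 : ℝ) • p.M2 N (P t) - c₀ • 1).PosSemidef)

/-! The rescaled low-dimensional system. -/

/-- E^N. -/
noncomputable def EN (N : ℕ) (Λ₁ Λ₂ : Matrix (Fin n) (Fin n) ℝ) :
    Matrix (Fin n₁) (Fin n₁) ℝ :=
  (1 / (N : ℝ)) •
    ((p.R2 Λ₁ Λ₂ - (1 / (N : ℝ)) • (p.B0ᵀ * Λ₂ * p.B0))⁻¹ - (p.R1 Λ₁)⁻¹)

/-- H^N. -/
noncomputable def HN (N : ℕ) (Λ₁ Λ₂ : Matrix (Fin n) (Fin n) ℝ) :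
    Matrix (Fin n₁) (Fin n₁) ℝ :=
  p.EN N Λ₁ Λ₂ + (p.R1 Λ₁)⁻¹

/-- g₁. -/
noncomputable def g₁ (N : ℕ) (Λ₁ Λ₂ : Matrix (Fin n) (Fin n) ℝ) :
    Matrix (Fin n) (Fin n) ℝ :=
  Λ₁ * p.B * p.EN N Λ₁ Λ₂ * p.Bᵀ * Λ₁
  + (1 - 1 / (N : ℝ)) •
      (Λ₂ * p.B * p.EN N Λ₁ Λ₂ * p.Bᵀ * Λ₁ + Λ₁ * p.B * p.EN N Λ₁ Λ₂ * p.Bᵀ * Λ₂)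
  + (1 / (N : ℝ) - 1 / (N : ℝ) ^ 2) •
      (Λ₂ * p.B * (p.HN N Λ₁ Λ₂ + ((N : ℝ) - 2) • p.EN N Λ₁ Λ₂) * p.Bᵀ * Λ₂)
  - (1 / (N : ℝ)) •
      ((Λ₁ * p.G + p.Gᵀ * Λ₁) + (1 - 1 / (N : ℝ)) • (Λ₂ * p.G + p.Gᵀ * Λ₂))
  - (1 / (N : ℝ)) • p.QΓ

/-- g₂. -/
noncomputable def g₂ (N : ℕ) (Λ₁ Λ₂ : Matrix (Fin n) (Fin n) ℝ) :
    Matrix (Fin n) (Fin n) ℝ :=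
  (Λ₁ + Λ₂) * p.B *
      ((N : ℝ) • p.EN N Λ₁ Λ₂ + (p.R1 Λ₁)⁻¹ - (p.R2 Λ₁ Λ₂)⁻¹) * p.Bᵀ * (Λ₁ + Λ₂)
  - (2 / (N : ℝ)) • (Λ₂ * p.B * (p.R1 Λ₁)⁻¹ * p.Bᵀ * Λ₂)
  + (1 / (N : ℝ) - 2) • (Λ₂ * p.B * p.EN N Λ₁ Λ₂ * p.Bᵀ * Λ₂)
  - Λ₁ * p.B * p.EN N Λ₁ Λ₂ * p.Bᵀ * Λ₂
  - Λ₂ * p.B * p.EN N Λ₁ Λ₂ * p.Bᵀ * Λ₁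
  + (1 / (N : ℝ)) • (Λ₂ * p.G + p.Gᵀ * Λ₂)

/-- Solution of the rescaled system (ODE-Λ^N) on [0,T]. -/
noncomputable def IsSolLamN (N : ℕ) (Λ₁ Λ₂ : ℝ → Matrix (Fin n) (Fin n) ℝ) : Prop :=
  (∀ t ∈ Icc (0 : ℝ) p.T, (Λ₁ t).IsSymm ∧ (Λ₂ t).IsSymm) ∧
  (∀ t ∈ Icc (0 : ℝ) p.T, (p.R1 (Λ₁ t)).PosDef ∧ (p.R2 (Λ₁ t) (Λ₂ t)).PosDef ∧
    (p.R2 (Λ₁ t) (Λ₂ t) - (1 / (N : ℝ)) • (p.B0ᵀ * Λ₂ t * p.B0)).PosDef) ∧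
  Λ₁ p.T = p.Qf + (1 / (N : ℝ)) • p.QfΓ ∧ Λ₂ p.T = p.QfΓ ∧
  (∀ t ∈ Icc (0 : ℝ) p.T, ∀ i j, HasDerivWithinAt (fun s => Λ₁ s i j)
    ((p.Ψ₁ (Λ₁ t) + p.g₁ N (Λ₁ t) (Λ₂ t)) i j) (Icc (0 : ℝ) p.T) t) ∧
  (∀ t ∈ Icc (0 : ℝ) p.T, ∀ i j, HasDerivWithinAt (fun s => Λ₂ s i j)
    ((p.Ψ₂ (Λ₁ t) (Λ₂ t) + p.g₂ N (Λ₁ t) (Λ₂ t)) i j) (Icc (0 : ℝ) p.T) t)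

/-! Companion (mean-field) equations. -/

/-- φ₁. -/
noncomputable def φ₁ (Λ₁ Λ₂ : Matrix (Fin n) (Fin n) ℝ) (S : Matrix (Fin n) (Fin 1) ℝ) :
    Matrix (Fin n) (Fin 1) ℝ :=
  (Λ₁ + Λ₂) * p.B * (p.R2 Λ₁ Λ₂)⁻¹ *
      (p.Bᵀ * S + p.B1ᵀ * Λ₁ * p.D + p.B0ᵀ * (Λ₁ + Λ₂) * p.D0)
    - (p.A + p.G)ᵀ * S

/-- φ₂. -/
noncomputable def φ₂ (Λ₁ Λ₂ : Matrix (Fin n) (Fin n) ℝ) (S : Matrix (Fin n) (Fin 1) ℝ) :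
    Matrix (Fin 1) (Fin 1) ℝ :=
  (Sᵀ * p.B + p.Dᵀ * Λ₁ * p.B1 + p.D0ᵀ * (Λ₁ + Λ₂) * p.B0) * (p.R2 Λ₁ Λ₂)⁻¹ *
      (p.Bᵀ * S + p.B1ᵀ * Λ₁ * p.D + p.B0ᵀ * (Λ₁ + Λ₂) * p.D0)
    - p.Dᵀ * Λ₁ * p.D - p.D0ᵀ * (Λ₁ + Λ₂) * p.D0

/-- Solution of the limiting companion system (ODE-Sr) on [0,T]. -/
noncomputable def IsSolSr (Λ₁ Λ₂ : ℝ → Matrix (Fin n) (Fin n) ℝ)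
    (S : ℝ → Matrix (Fin n) (Fin 1) ℝ) (r : ℝ → ℝ) : Prop :=
  S p.T = 0 ∧ r p.T = 0 ∧
  (∀ t ∈ Icc (0 : ℝ) p.T, ∀ i j, HasDerivWithinAt (fun s => S s i j)
    (p.φ₁ (Λ₁ t) (Λ₂ t) (S t) i j) (Icc (0 : ℝ) p.T) t) ∧
  (∀ t ∈ Icc (0 : ℝ) p.T, HasDerivWithinAt r
    ((p.φ₂ (Λ₁ t) (Λ₂ t) (S t)) 0 0) (Icc (0 : ℝ) p.T) t)

/-- g₀₁. -/
noncomputable def g01 (N : ℕ) (Λ₁ Λ₂ : Matrix (Fin n) (Fin n) ℝ)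
    (S : Matrix (Fin n) (Fin 1) ℝ) : Matrix (Fin n) (Fin 1) ℝ :=
  (Λ₁ + (1 - 1 / (N : ℝ)) • Λ₂) * p.B *
      (p.R2 Λ₁ Λ₂ - (1 / (N : ℝ)) • (p.B0ᵀ * Λ₂ * p.B0))⁻¹ *
      (p.Bᵀ * S + p.B1ᵀ * Λ₁ * p.D + p.B0ᵀ * (Λ₁ + (1 - 1 / (N : ℝ)) • Λ₂) * p.D0)
  - (Λ₁ + Λ₂) * p.B * (p.R2 Λ₁ Λ₂)⁻¹ *
      (p.Bᵀ * S + p.B1ᵀ * Λ₁ * p.D + p.B0ᵀ * (Λ₁ + Λ₂) * p.D0)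

/-- g₀₂. -/
noncomputable def g02 (N : ℕ) (Λ₁ Λ₂ : Matrix (Fin n) (Fin n) ℝ)
    (S : Matrix (Fin n) (Fin 1) ℝ) : Matrix (Fin 1) (Fin 1) ℝ :=
  (Sᵀ * p.B + p.Dᵀ * Λ₁ * p.B1 + p.D0ᵀ * (Λ₁ + (1 - 1 / (N : ℝ)) • Λ₂) * p.B0) *
      (p.R2 Λ₁ Λ₂ - (1 / (N : ℝ)) • (p.B0ᵀ * Λ₂ * p.B0))⁻¹ *
      (p.Bᵀ * S + p.B1ᵀ * Λ₁ * p.D + p.B0ᵀ * (Λ₁ + (1 - 1 / (N : ℝ)) • Λ₂) * p.D0)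
  - (Sᵀ * p.B + p.Dᵀ * Λ₁ * p.B1 + p.D0ᵀ * (Λ₁ + Λ₂) * p.B0) * (p.R2 Λ₁ Λ₂)⁻¹ *
      (p.Bᵀ * S + p.B1ᵀ * Λ₁ * p.D + p.B0ᵀ * (Λ₁ + Λ₂) * p.D0)
  + (1 / (N : ℝ)) • (p.D0ᵀ * Λ₂ * p.D0)

/-- Solution of the rescaled companion system (ODE-S^N r^N) on [0,T]. -/
noncomputable def IsSolSrN (N : ℕ) (Λ₁ Λ₂ : ℝ → Matrix (Fin n) (Fin n) ℝ)
    (S : ℝ → Matrix (Fin n) (Fin 1) ℝ) (r : ℝ → ℝ) : Prop :=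
  S p.T = 0 ∧ r p.T = 0 ∧
  (∀ t ∈ Icc (0 : ℝ) p.T, ∀ i j, HasDerivWithinAt (fun s => S s i j)
    ((p.φ₁ (Λ₁ t) (Λ₂ t) (S t) + p.g01 N (Λ₁ t) (Λ₂ t) (S t)) i j) (Icc (0 : ℝ) p.T) t) ∧
  (∀ t ∈ Icc (0 : ℝ) p.T, HasDerivWithinAt r
    ((p.φ₂ (Λ₁ t) (Λ₂ t) (S t) + p.g02 N (Λ₁ t) (Λ₂ t) (S t)) 0 0) (Icc (0 : ℝ) p.T) t)

/-! Feedback gains. -/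

/-- Θ = ℛ₁(Λ₁)⁻¹ Bᵀ Λ₁. -/
noncomputable def Theta (Λ₁ : Matrix (Fin n) (Fin n) ℝ) : Matrix (Fin n₁) (Fin n) ℝ :=
  (p.R1 Λ₁)⁻¹ * p.Bᵀ * Λ₁

/-- Θ₁ = (H₁ − H)Bᵀ(Λ₁+Λ₂) + HBᵀΛ₂. -/
noncomputable def Theta1 (Λ₁ Λ₂ : Matrix (Fin n) (Fin n) ℝ) : Matrix (Fin n₁) (Fin n) ℝ :=
  ((p.R2 Λ₁ Λ₂)⁻¹ - (p.R1 Λ₁)⁻¹) * p.Bᵀ * (Λ₁ + Λ₂) + (p.R1 Λ₁)⁻¹ * p.Bᵀ * Λ₂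

/-- Θ₂ = H₁[BᵀS + B₁ᵀΛ₁D + B₀ᵀ(Λ₁+Λ₂)D₀]. -/
noncomputable def Theta2 (Λ₁ Λ₂ : Matrix (Fin n) (Fin n) ℝ) (S : Matrix (Fin n) (Fin 1) ℝ) :
    Matrix (Fin n₁) (Fin 1) ℝ :=
  (p.R2 Λ₁ Λ₂)⁻¹ * (p.Bᵀ * S + p.B1ᵀ * Λ₁ * p.D + p.B0ᵀ * (Λ₁ + Λ₂) * p.D0)

/-- Θ^N. -/
noncomputable def ThetaN (N : ℕ) (Λ₁ Λ₂ : Matrix (Fin n) (Fin n) ℝ) :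
    Matrix (Fin n₁) (Fin n) ℝ :=
  (p.HN N Λ₁ Λ₂ - p.EN N Λ₁ Λ₂) * p.Bᵀ * (Λ₁ - (1 / (N : ℝ)) • Λ₂)

/-- Θ₁^N. -/
noncomputable def Theta1N (N : ℕ) (Λ₁ Λ₂ : Matrix (Fin n) (Fin n) ℝ) :
    Matrix (Fin n₁) (Fin n) ℝ :=
  (N : ℝ) • (p.EN N Λ₁ Λ₂ * p.Bᵀ * Λ₁)
    + (p.HN N Λ₁ Λ₂ + ((N : ℝ) - 2) • p.EN N Λ₁ Λ₂) * p.Bᵀ * Λ₂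

/-- Θ₂^N. -/
noncomputable def Theta2N (N : ℕ) (Λ₁ Λ₂ : Matrix (Fin n) (Fin n) ℝ)
    (S : Matrix (Fin n) (Fin 1) ℝ) : Matrix (Fin n₁) (Fin 1) ℝ :=
  (p.HN N Λ₁ Λ₂ + ((N : ℝ) - 1) • p.EN N Λ₁ Λ₂) *
    (p.Bᵀ * S + p.B1ᵀ * Λ₁ * p.D + p.B0ᵀ * (Λ₁ + (1 - 1 / (N : ℝ)) • Λ₂) * p.D0)

/-- Z₀ = −B₀(Θ + Θ₁). -/
noncomputable def Z0 (Λ₁ Λ₂ : Matrix (Fin n) (Fin n) ℝ) : Matrix (Fin n) (Fin n) ℝ :=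
  -(p.B0 * (p.Theta Λ₁ + p.Theta1 Λ₁ Λ₂))

/-- Z₁ = A + G − B(Θ + Θ₁). -/
noncomputable def Z1 (Λ₁ Λ₂ : Matrix (Fin n) (Fin n) ℝ) : Matrix (Fin n) (Fin n) ℝ :=
  p.A + p.G - p.B * (p.Theta Λ₁ + p.Theta1 Λ₁ Λ₂)

/-! The high-dimensional equations under the decentralized control. -/

/-- RHS of (ODE-P̌₁) (paper's −d𝐏̌₁/dt). -/
noncomputable def Pcheck1RHS (N : ℕ) (Θ : Matrix (Fin n₁) (Fin n) ℝ)
    (P1 : Matrix (Fin N × Fin n) (Fin N × Fin n) ℝ) :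
    Matrix (Fin N × Fin n) (Fin N × Fin n) ℝ :=
  (kronIN N Θ)ᵀ * (p.bigR N + p.M2 N ((2 : ℝ) • P1)) * kronIN N Θ
    + P1 * (p.bigA N - p.bigBhat N * kronIN N Θ)
    + (p.bigA N - p.bigBhat N * kronIN N Θ)ᵀ * P1
    + p.bigQ N

/-- Solution of (ODE-P̌₁) on [0,T], with Θ(t) built from Λ₁(t). -/
noncomputable def IsSolPcheck1 (N : ℕ) (Λ₁ : ℝ → Matrix (Fin n) (Fin n) ℝ)
    (P1 : ℝ → Matrix (Fin N × Fin n) (Fin N × Fin n) ℝ) : Prop :=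
  P1 p.T = p.bigQf N ∧
  (∀ t ∈ Icc (0 : ℝ) p.T, ∀ x y, HasDerivWithinAt (fun s => P1 s x y)
    ((-(p.Pcheck1RHS N (p.Theta (Λ₁ t)) (P1 t))) x y) (Icc (0 : ℝ) p.T) t)

/-- RHS of (ODE-P̌₁₂) (paper's −d𝐏̌₁₂/dt). -/
noncomputable def Pcheck12RHS (N : ℕ) (Λ₁m Λ₂m : Matrix (Fin n) (Fin n) ℝ)
    (P1 : Matrix (Fin N × Fin n) (Fin N × Fin n) ℝ)
    (P12 : Matrix (Fin N × Fin n) (Fin n) ℝ) :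
    Matrix (Fin N × Fin n) (Fin n) ℝ :=
  (kronIN N (p.Theta Λ₁m))ᵀ * (p.bigR N + p.M2 N ((2 : ℝ) • P1)) *
      stackN N (p.Theta1 Λ₁m Λ₂m)
    - P1 * p.bigBhat N * stackN N (p.Theta1 Λ₁m Λ₂m)
    + ((p.bigA N)ᵀ - (kronIN N (p.Theta Λ₁m))ᵀ * (p.bigBhat N)ᵀ) * P12
    + P12 * p.Z1 Λ₁m Λ₂m
    - (kronIN N (p.Theta Λ₁m))ᵀ * (p.bigIhat N)ᵀ * (p.bigB0 N)ᵀ * P12 * p.Z0 Λ₁m Λ₂m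

/-- Solution of (ODE-P̌₁₂) on [0,T]. -/
noncomputable def IsSolPcheck12 (N : ℕ) (Λ₁ Λ₂ : ℝ → Matrix (Fin n) (Fin n) ℝ)
    (P1 : ℝ → Matrix (Fin N × Fin n) (Fin N × Fin n) ℝ)
    (P12 : ℝ → Matrix (Fin N × Fin n) (Fin n) ℝ) : Prop :=
  P12 p.T = 0 ∧
  (∀ t ∈ Icc (0 : ℝ) p.T, ∀ x y, HasDerivWithinAt (fun s => P12 s x y)
    ((-(p.Pcheck12RHS N (Λ₁ t) (Λ₂ t) (P1 t) (P12 t))) x y) (Icc (0 : ℝ) p.T) t)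

/-! The decentralized-control low-dimensional coefficient system. -/

/-- ǧ₁. -/
noncomputable def gc1 (N : ℕ) (Θ : Matrix (Fin n₁) (Fin n) ℝ)
    (L1 L2 : Matrix (Fin n) (Fin n) ℝ) : Matrix (Fin n) (Fin n) ℝ :=
  (1 / (N : ℝ)) •
    (Θᵀ * p.B0ᵀ * (L1 + (1 - 1 / (N : ℝ)) • L2) * p.B0 * Θ
      + (L1 + (1 - 1 / (N : ℝ)) • L2) * p.G
      + p.Gᵀ * (L1 + (1 - 1 / (N : ℝ)) • L2)
      + p.QΓ)

/-- ǧ₂. -/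
noncomputable def gc2 (N : ℕ) (Θ : Matrix (Fin n₁) (Fin n) ℝ)
    (L2 : Matrix (Fin n) (Fin n) ℝ) : Matrix (Fin n) (Fin n) ℝ :=
  -((1 / (N : ℝ)) • (Θᵀ * p.B0ᵀ * L2 * p.B0 * Θ + L2 * p.G + p.Gᵀ * L2))

/-- ǧ₁₂. -/
noncomputable def gc12 (N : ℕ) (Θ Θ₁ : Matrix (Fin n₁) (Fin n) ℝ)
    (L2 : Matrix (Fin n) (Fin n) ℝ) : Matrix (Fin n) (Fin n) ℝ :=
  (1 / (N : ℝ)) • (-(Θᵀ * p.B0ᵀ * L2 * p.B0 * Θ₁) + L2 * p.B * Θ₁)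

/-- ǧ₂₂. -/
noncomputable def gc22 (N : ℕ) (Θ₁ : Matrix (Fin n₁) (Fin n) ℝ)
    (L2 : Matrix (Fin n) (Fin n) ℝ) : Matrix (Fin n) (Fin n) ℝ :=
  -((1 / (N : ℝ)) • (Θ₁ᵀ * p.B0ᵀ * L2 * p.B0 * Θ₁))

/-- ǧ₀₁. -/
noncomputable def gc01 (N : ℕ) (Θ : Matrix (Fin n₁) (Fin n) ℝ)
    (Θ₂ : Matrix (Fin n₁) (Fin 1) ℝ) (L2 : Matrix (Fin n) (Fin n) ℝ) :
    Matrix (Fin n) (Fin 1) ℝ :=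
  (1 / (N : ℝ)) • (Θᵀ * p.B0ᵀ * L2 * (p.D0 - p.B0 * Θ₂) + L2 * p.B * Θ₂)

/-- ǧ₀₂. -/
noncomputable def gc02 (N : ℕ) (Θ₁ : Matrix (Fin n₁) (Fin n) ℝ)
    (Θ₂ : Matrix (Fin n₁) (Fin 1) ℝ) (L2 : Matrix (Fin n) (Fin n) ℝ) :
    Matrix (Fin n) (Fin 1) ℝ :=
  (1 / (N : ℝ)) • (-(Θ₁ᵀ * p.B0ᵀ * L2 * p.B0 * Θ₂) + Θ₁ᵀ * p.B0ᵀ * L2 * p.D0)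

/-- RHS of (ODE-Λ̌₁^N) (paper's −dΛ̌₁^N/dt). -/
noncomputable def check1RHS (N : ℕ) (Θ : Matrix (Fin n₁) (Fin n) ℝ)
    (L1 L2 : Matrix (Fin n) (Fin n) ℝ) : Matrix (Fin n) (Fin n) ℝ :=
  Θᵀ * p.R1 L1 * Θ + L1 * (p.A - p.B * Θ) + (p.A - p.B * Θ)ᵀ * L1 + p.Q
    + p.gc1 N Θ L1 L2

/-- RHS of (ODE-Λ̌₂^N). -/
noncomputable def check2RHS (N : ℕ) (Θ : Matrix (Fin n₁) (Fin n) ℝ)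
    (L1 L2 : Matrix (Fin n) (Fin n) ℝ) : Matrix (Fin n) (Fin n) ℝ :=
  Θᵀ * p.B0ᵀ * (L1 + L2) * p.B0 * Θ + L1 * p.G + p.Gᵀ * L1
    + L2 * (p.A + p.G - p.B * Θ) + (p.A + p.G - p.B * Θ)ᵀ * L2 + p.QΓ
    + p.gc2 N Θ L2

/-- RHS of (ODE-Λ̌₁₂^N). -/
noncomputable def check12RHS (N : ℕ) (Θ Θ₁ : Matrix (Fin n₁) (Fin n) ℝ)
    (L1 L2 L12 : Matrix (Fin n) (Fin n) ℝ) : Matrix (Fin n) (Fin n) ℝ :=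
  Θᵀ * p.R2 L1 L2 * Θ₁ + Θᵀ * p.B0ᵀ * L12 * p.B0 * (Θ + Θ₁)
    - (L1 + L2) * p.B * Θ₁
    + (p.A + p.G - p.B * Θ)ᵀ * L12
    + L12 * (p.A + p.G - p.B * (Θ₁ + Θ))
    + p.gc12 N Θ Θ₁ L2

/-- RHS of (ODE-Λ̌₂₂^N). -/
noncomputable def check22RHS (N : ℕ) (Θ₁ : Matrix (Fin n₁) (Fin n) ℝ)
    (Z₀ Z₁ : Matrix (Fin n) (Fin n) ℝ)
    (L1 L2 L12 L22 : Matrix (Fin n) (Fin n) ℝ) : Matrix (Fin n) (Fin n) ℝ :=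
  Θ₁ᵀ * p.R2 L1 L2 * Θ₁ - L12ᵀ * p.B * Θ₁ - Θ₁ᵀ * p.Bᵀ * L12
    + L22 * Z₁ + Z₁ᵀ * L22
    - Z₀ᵀ * L12ᵀ * p.B0 * Θ₁ - Θ₁ᵀ * p.B0ᵀ * L12 * Z₀
    + Z₀ᵀ * L22 * Z₀ + p.gc22 N Θ₁ L2

/-- RHS of (ODE-Š₁^N). -/
noncomputable def checkS1RHS (N : ℕ) (Θ : Matrix (Fin n₁) (Fin n) ℝ)
    (Θ₂ : Matrix (Fin n₁) (Fin 1) ℝ) (L1 L2 L12 : Matrix (Fin n) (Fin n) ℝ)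
    (S1 : Matrix (Fin n) (Fin 1) ℝ) : Matrix (Fin n) (Fin 1) ℝ :=
  Θᵀ * p.R2 L1 L2 * Θ₂ - (L1 + L2 + L12) * p.B * Θ₂
    - Θᵀ * (p.Bᵀ * S1 + p.B1ᵀ * L1 * p.D + p.B0ᵀ * (L1 + L2) * p.D0)
    - Θᵀ * p.B0ᵀ * L12 * (p.D0 - p.B0 * Θ₂)
    + (p.A + p.G)ᵀ * S1
    + p.gc01 N Θ Θ₂ L2

/-- RHS of (ODE-Š₂^N). -/
noncomputable def checkS2RHS (N : ℕ) (Θ₁ : Matrix (Fin n₁) (Fin n) ℝ)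
    (Θ₂ : Matrix (Fin n₁) (Fin 1) ℝ) (Z₀ Z₁ : Matrix (Fin n) (Fin n) ℝ)
    (L1 L2 L12 L22 : Matrix (Fin n) (Fin n) ℝ)
    (S1 S2 : Matrix (Fin n) (Fin 1) ℝ) : Matrix (Fin n) (Fin 1) ℝ :=
  Θ₁ᵀ * p.R2 L1 L2 * Θ₂ + Z₁ᵀ * S2
    - Θ₁ᵀ * (p.Bᵀ * S1 + p.B1ᵀ * L1 * p.D + p.B0ᵀ * (L1 + L2) * p.D0)
    + (Z₀ᵀ * L22 + Z₀ᵀ * L12ᵀ - Θ₁ᵀ * p.B0ᵀ * L12) * (p.D0 - p.B0 * Θ₂)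
    - (L12ᵀ + L22) * p.B * Θ₂
    + p.gc02 N Θ₁ Θ₂ L2

/-- Solution of the pair (ODE-Λ̌₁^N)–(ODE-Λ̌₂^N) on [0,T], with Θ(t) from the limiting Λ₁. -/
noncomputable def IsSolCheckA (N : ℕ) (Λ₁ : ℝ → Matrix (Fin n) (Fin n) ℝ)
    (L1 L2 : ℝ → Matrix (Fin n) (Fin n) ℝ) : Prop :=
  L1 p.T = p.Qf + (1 / (N : ℝ)) • p.QfΓ ∧ L2 p.T = p.QfΓ ∧
  (∀ t ∈ Icc (0 : ℝ) p.T, ∀ i j, HasDerivWithinAt (fun s => L1 s i j)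
    ((-(p.check1RHS N (p.Theta (Λ₁ t)) (L1 t) (L2 t))) i j) (Icc (0 : ℝ) p.T) t) ∧
  (∀ t ∈ Icc (0 : ℝ) p.T, ∀ i j, HasDerivWithinAt (fun s => L2 s i j)
    ((-(p.check2RHS N (p.Theta (Λ₁ t)) (L1 t) (L2 t))) i j) (Icc (0 : ℝ) p.T) t)

/-- Solution of (ODE-Λ̌₁^N)–(ODE-Λ̌₂₂^N) on [0,T], with Θ, Θ₁, Z₀, Z₁ from the limiting (Λ₁, Λ₂). -/
noncomputable def IsSolCheckB (N : ℕ) (Λ₁ Λ₂ : ℝ → Matrix (Fin n) (Fin n) ℝ)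
    (L1 L2 L12 L22 : ℝ → Matrix (Fin n) (Fin n) ℝ) : Prop :=
  p.IsSolCheckA N Λ₁ L1 L2 ∧
  L12 p.T = 0 ∧ L22 p.T = 0 ∧
  (∀ t ∈ Icc (0 : ℝ) p.T, ∀ i j, HasDerivWithinAt (fun s => L12 s i j)
    ((-(p.check12RHS N (p.Theta (Λ₁ t)) (p.Theta1 (Λ₁ t) (Λ₂ t))
        (L1 t) (L2 t) (L12 t))) i j) (Icc (0 : ℝ) p.T) t) ∧
  (∀ t ∈ Icc (0 : ℝ) p.T, ∀ i j, HasDerivWithinAt (fun s => L22 s i j)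
    ((-(p.check22RHS N (p.Theta1 (Λ₁ t) (Λ₂ t)) (p.Z0 (Λ₁ t) (Λ₂ t))
        (p.Z1 (Λ₁ t) (Λ₂ t)) (L1 t) (L2 t) (L12 t) (L22 t))) i j) (Icc (0 : ℝ) p.T) t)

/-- Solution of the full decentralized coefficient system on [0,T],
with Θ, Θ₁, Θ₂, Z₀, Z₁ from the limiting (Λ₁, Λ₂, S). -/
noncomputable def IsSolCheckC (N : ℕ) (Λ₁ Λ₂ : ℝ → Matrix (Fin n) (Fin n) ℝ)
    (S : ℝ → Matrix (Fin n) (Fin 1) ℝ)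
    (L1 L2 L12 L22 : ℝ → Matrix (Fin n) (Fin n) ℝ)
    (S1 S2 : ℝ → Matrix (Fin n) (Fin 1) ℝ) : Prop :=
  p.IsSolCheckB N Λ₁ Λ₂ L1 L2 L12 L22 ∧
  S1 p.T = 0 ∧ S2 p.T = 0 ∧
  (∀ t ∈ Icc (0 : ℝ) p.T, ∀ i j, HasDerivWithinAt (fun s => S1 s i j)
    ((-(p.checkS1RHS N (p.Theta (Λ₁ t)) (p.Theta2 (Λ₁ t) (Λ₂ t) (S t))
        (L1 t) (L2 t) (L12 t) (S1 t))) i j) (Icc (0 : ℝ) p.T) t) ∧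
  (∀ t ∈ Icc (0 : ℝ) p.T, ∀ i j, HasDerivWithinAt (fun s => S2 s i j)
    ((-(p.checkS2RHS N (p.Theta1 (Λ₁ t) (Λ₂ t)) (p.Theta2 (Λ₁ t) (Λ₂ t) (S t))
        (p.Z0 (Λ₁ t) (Λ₂ t)) (p.Z1 (Λ₁ t) (Λ₂ t))
        (L1 t) (L2 t) (L12 t) (L22 t) (S1 t) (S2 t))) i j) (Icc (0 : ℝ) p.T) t)

end Params

section Perturbation

variable {E : Type*} [NormedAddCommGroup E] [NormedSpace ℝ E]

/-- A vector field that is `C¹` along a compact curve at parameter `0` satisfies a uniform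
one-sided Lipschitz estimate in a tube around that curve. -/
lemma exists_tube_lipschitz {T : ℝ} (F : ℝ × E → E) (x : ℝ → E)
    (hx : ContinuousOn x (Icc 0 T))
    (hF : ∀ t ∈ Icc (0 : ℝ) T, ContDiffAt ℝ 1 F (0, x t)) :
    ∃ δ : ℝ, 0 < δ ∧ ∃ K : ℝ, 0 < K ∧ ∀ t ∈ Icc (0 : ℝ) T, ∀ (ε : ℝ) (y : E),
      |ε| ≤ δ → ‖y - x t‖ ≤ δ → ‖F (ε, y) - F (0, x t)‖ ≤ K * (‖y - x t‖ + |ε|) := by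
  refine isCompact_Icc.induction_on (p := fun s => ∃ δ : ℝ, 0 < δ ∧ ∃ K : ℝ, 0 < K ∧
    ∀ t ∈ s, ∀ (ε : ℝ) (y : E), |ε| ≤ δ → ‖y - x t‖ ≤ δ →
      ‖F (ε, y) - F (0, x t)‖ ≤ K * (‖y - x t‖ + |ε|)) ?_ ?_ ?_ ?_
  · exact ⟨1, one_pos, 1, one_pos, fun t ht => ht.elim⟩
  · rintro s t hst ⟨δ, hδ, K, hK, h⟩
    exact ⟨δ, hδ, K, hK, fun u hu => h u (hst hu)⟩
  · rintro s t ⟨δ, hδ, K, hK, h⟩ ⟨δ', hδ', K', hK', h'⟩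
    refine ⟨min δ δ', lt_min hδ hδ', max K K', lt_max_of_lt_left hK, ?_⟩
    rintro u (hu | hu) ε y hε hy
    · refine (h u hu ε y (hε.trans (min_le_left _ _)) (hy.trans (min_le_left _ _))).trans ?_
      exact mul_le_mul_of_nonneg_right (le_max_left _ _) (by positivity)
    · refine (h' u hu ε y (hε.trans (min_le_right _ _)) (hy.trans (min_le_right _ _))).trans ?_
      exact mul_le_mul_of_nonneg_right (le_max_right _ _) (by positivity)
  · intro t₀ ht₀
    obtain ⟨K, U, hU, hL⟩ := (hF t₀ ht₀).exists_lipschitzOnWith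
    obtain ⟨r, hr, hrU⟩ := Metric.mem_nhds_iff.1 hU
    refine ⟨{t | dist (x t) (x t₀) < r / 2}, ?_, r / 3, by positivity, K + 1, by positivity, ?_⟩
    · exact (hx t₀ ht₀).tendsto.eventually (Metric.ball_mem_nhds (x t₀) (half_pos hr))
    · intro t ht ε y hε hy
      have ht' : dist (x t) (x t₀) < r / 2 := ht
      have h1 : (ε, y) ∈ U := by
        apply hrU
        rw [Metric.mem_ball, Prod.dist_eq, max_lt_iff]
        refine ⟨by rw [Real.dist_eq, sub_zero]; linarith, ?_⟩
        have := dist_triangle y (x t) (x t₀)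
        rw [dist_eq_norm y (x t)] at this
        show dist y (x t₀) < r
        linarith
      have h2 : ((0 : ℝ), x t) ∈ U := by
        apply hrU
        rw [Metric.mem_ball, Prod.dist_eq, max_lt_iff]
        refine ⟨by simpa using hr, ?_⟩
        show dist (x t) (x t₀) < r
        linarith
      have h3 := hL.norm_sub_le h1 h2
      have h4 : ‖((ε, y) : ℝ × E) - (0, x t)‖ ≤ ‖y - x t‖ + |ε| := by
        rw [Prod.mk_sub_mk, Prod.norm_mk, sub_zero, Real.norm_eq_abs]
        exact max_le (le_add_of_nonneg_left (norm_nonneg _)) (le_add_of_nonneg_right (abs_nonneg _))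
      have h5 : (0 : ℝ) ≤ K := K.2
      calc ‖F (ε, y) - F (0, x t)‖ ≤ K * ‖((ε, y) : ℝ × E) - (0, x t)‖ := h3
        _ ≤ K * (‖y - x t‖ + |ε|) := by gcongr
        _ ≤ (K + 1) * (‖y - x t‖ + |ε|) := by gcongr; linarith

lemma hasDerivWithinAt_timeReversal {T : ℝ} {f : ℝ → E} {f' : E} {t : ℝ}
    (h : HasDerivWithinAt f f' (Icc 0 T) (T - t)) :
    HasDerivWithinAt (fun s => f (T - s)) (-f') (Icc 0 T) t := by
  have h2 : HasDerivWithinAt (fun s : ℝ => T - s) (-1) (Icc 0 T) t := by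
    simpa using (hasDerivWithinAt_id t (Icc 0 T)).const_sub T
  have := HasDerivWithinAt.scomp t h h2
    (fun s hs => ⟨by linarith [hs.2], by linarith [hs.1]⟩)
  simpa [Function.comp_def] using this

/-- First-order continuity of solutions of a terminal value problem on a compact interval with
respect to a small parameter `1 / N`: no a priori bound on the perturbed solution is required. -/
theorem terminal_value_perturbation {T : ℝ} (F : ℝ × E → E) (x : ℝ → E)
    (hx : ∀ t ∈ Icc (0 : ℝ) T, HasDerivWithinAt x (F (0, x t)) (Icc 0 T) t)
    (hF : ∀ t ∈ Icc (0 : ℝ) T, ContDiffAt ℝ 1 F (0, x t)) (c : ℝ) :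
    ∃ N₁ : ℕ, 1 ≤ N₁ ∧ ∃ C : ℝ, 0 < C ∧ ∀ N : ℕ, N₁ ≤ N → ∀ y : ℝ → E,
      (∀ t ∈ Icc (0 : ℝ) T, HasDerivWithinAt y (F (1 / (N : ℝ), y t)) (Icc 0 T) t) →
      ‖y T - x T‖ ≤ c / N → ∀ t ∈ Icc (0 : ℝ) T, ‖y t - x t‖ ≤ C / N := by
  have hxc : ContinuousOn x (Icc 0 T) := fun t ht => (hx t ht).continuousWithinAt
  obtain ⟨δ, hδ, K, hK, hest⟩ := exists_tube_lipschitz F x hxc hF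
  set L : ℝ := 2 * K + 1 with hL
  set a : ℝ := |c| + 1 with ha
  have ha1 : 1 ≤ a := by rw [ha]; linarith [abs_nonneg c]
  have ha0 : 0 < a := by linarith
  set C : ℝ := a * Real.exp (L * T) with hC
  have hC0 : 0 < C := by positivity
  obtain ⟨N₀, hN₀⟩ := exists_nat_ge (max (C / δ) (1 / δ))
  refine ⟨N₀ + 1, by omega, C, hC0, ?_⟩
  intro N hN y hy hyT
  have hNr : (N₀ : ℝ) + 1 ≤ N := by exact_mod_cast hN
  have hN0 : (0 : ℝ) < N := by have : (0 : ℝ) ≤ N₀ := by positivity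
                               linarith
  set ε : ℝ := 1 / (N : ℝ) with hε
  have hε0 : 0 < ε := by positivity
  have hCε : C * ε ≤ δ := by
    have : C / δ ≤ N := by linarith [le_max_left (C / δ) (1 / δ)]
    rw [div_le_iff₀ hδ] at this
    rw [hε, mul_one_div, div_le_iff₀ hN0]; linarith
  have hεδ : |ε| ≤ δ := by
    have : 1 / δ ≤ N := by linarith [le_max_right (C / δ) (1 / δ)]
    rw [div_le_iff₀ hδ] at this
    rw [abs_of_pos hε0, hε, div_le_iff₀ hN0]; linarith
  have hflip : ∀ t ∈ Icc (0 : ℝ) T, T - t ∈ Icc (0 : ℝ) T :=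
    fun t ht => ⟨by linarith [ht.2], by linarith [ht.1]⟩
  have hder : ∀ t ∈ Icc (0 : ℝ) T, HasDerivWithinAt (fun s => y (T - s) - x (T - s))
      (-(F (ε, y (T - t))) - -(F (0, x (T - t)))) (Icc 0 T) t := fun t ht =>
    (hasDerivWithinAt_timeReversal (hy _ (hflip t ht))).sub
      (hasDerivWithinAt_timeReversal (hx _ (hflip t ht)))
  have hB : ∀ t : ℝ, HasDerivAt (fun s => ε * a * Real.exp (L * s))
      (L * (ε * a * Real.exp (L * t))) t := by
    intro t
    have h1 : HasDerivAt (fun s : ℝ => L * s) L t := by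
      simpa using (hasDerivAt_id t).const_mul L
    have := (h1.exp).const_mul (ε * a)
    exact this.congr_deriv (by ring)
  have key := image_norm_le_of_norm_deriv_right_lt_deriv_boundary
    (f := fun s => y (T - s) - x (T - s)) (a := 0) (b := T)
    (f' := fun t => -(F (ε, y (T - t))) - -(F (0, x (T - t))))
    (fun t ht => (hder t ht).continuousWithinAt)
    (fun t ht => (hder t ⟨ht.1, ht.2.le⟩).mono_of_mem_nhdsWithin
      (Icc_mem_nhdsGE_of_mem ht))
    (B := fun s => ε * a * Real.exp (L * s)) (B' := fun t => L * (ε * a * Real.exp (L * t)))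
    ?_ hB ?_
  · intro t ht
    have h1 := key (hflip t ht)
    simp only [sub_sub_cancel] at h1
    refine h1.trans ?_
    have : Real.exp (L * (T - t)) ≤ Real.exp (L * T) := by
      apply Real.exp_le_exp.2
      have : 0 < L := by positivity
      nlinarith [ht.1]
    calc ε * a * Real.exp (L * (T - t)) ≤ ε * a * Real.exp (L * T) := by gcongr
      _ = C / N := by rw [hC, hε]; ring
  · simp only [sub_zero, mul_zero, Real.exp_zero, mul_one]
    refine hyT.trans ?_
    rw [hε, div_mul_eq_mul_div, one_mul]
    gcongr
    linarith [le_abs_self c]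
  · intro t ht hnorm
    have ht' : t ∈ Icc (0 : ℝ) T := ⟨ht.1, ht.2.le⟩
    have hexp1 : 1 ≤ Real.exp (L * t) := Real.one_le_exp (mul_nonneg (by positivity) ht.1)
    have hexp2 : Real.exp (L * t) ≤ Real.exp (L * T) := by
      apply Real.exp_le_exp.2
      exact mul_le_mul_of_nonneg_left ht'.2 (by positivity)
    have hle : ‖y (T - t) - x (T - t)‖ ≤ δ := by
      rw [hnorm]
      refine le_trans ?_ hCε
      calc ε * a * Real.exp (L * t) ≤ ε * a * Real.exp (L * T) := by gcongr
        _ = C * ε := by rw [hC]; ring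
    have h1 := hest (T - t) (hflip t ht') ε (y (T - t)) hεδ hle
    have h2 : ‖-(F (ε, y (T - t))) - -(F (0, x (T - t)))‖
        = ‖F (ε, y (T - t)) - F (0, x (T - t))‖ := by
      rw [← norm_neg]; congr 1; abel
    have h3 : ε ≤ ε * a * Real.exp (L * t) := by
      have : 1 ≤ a * Real.exp (L * t) := one_le_mul_of_one_le_of_one_le ha1 hexp1
      nlinarith
    show ‖-(F (ε, y (T - t))) - -(F (0, x (T - t)))‖ < L * (ε * a * Real.exp (L * t))
    rw [h2]
    refine h1.trans_lt ?_
    rw [hnorm, abs_of_pos hε0, hL]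
    nlinarith

end Perturbation

section MatrixCalculus

attribute [local instance] Matrix.normedAddCommGroup Matrix.normedSpace

variable {E : Type*} [NormedAddCommGroup E] [NormedSpace ℝ E] {a b c : ℕ}

lemma contDiffAt_matrix {f : E → Matrix (Fin a) (Fin b) ℝ} {z : E} :
    ContDiffAt ℝ 1 f z ↔ ∀ i j, ContDiffAt ℝ 1 (fun w => f w i j) z :=
  contDiffAt_pi.trans (forall_congr' fun _ => contDiffAt_pi)

lemma hasDerivWithinAt_matrix {f : ℝ → Matrix (Fin a) (Fin b) ℝ} {f' : Matrix (Fin a) (Fin b) ℝ}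
    {s : Set ℝ} {t : ℝ} :
    HasDerivWithinAt f f' s t ↔ ∀ i j, HasDerivWithinAt (fun u => f u i j) (f' i j) s t :=
  hasDerivWithinAt_pi.trans (forall_congr' fun _ => hasDerivWithinAt_pi)

@[fun_prop]
lemma contDiffAt_matrix_mul {f : E → Matrix (Fin a) (Fin b) ℝ}
    {g : E → Matrix (Fin b) (Fin c) ℝ} {z : E} (hf : ContDiffAt ℝ 1 f z)
    (hg : ContDiffAt ℝ 1 g z) : ContDiffAt ℝ 1 (fun w => f w * g w) z := by
  rw [contDiffAt_matrix] at *
  intro i j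
  simp only [Matrix.mul_apply]
  exact ContDiffAt.sum fun k _ => (hf i k).mul (hg k j)

@[fun_prop]
lemma contDiffAt_matrix_transpose {f : E → Matrix (Fin a) (Fin b) ℝ} {z : E}
    (hf : ContDiffAt ℝ 1 f z) : ContDiffAt ℝ 1 (fun w => (f w)ᵀ) z := by
  rw [contDiffAt_matrix] at *
  exact fun i j => hf j i

lemma contDiffAt_matrix_det {f : E → Matrix (Fin a) (Fin a) ℝ} {z : E}
    (hf : ContDiffAt ℝ 1 f z) : ContDiffAt ℝ 1 (fun w => (f w).det) z := by
  rw [contDiffAt_matrix] at hf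
  simp only [Matrix.det_apply]
  exact ContDiffAt.sum fun σ _ => (contDiffAt_prod fun i _ => hf (σ i) i).const_smul _

@[fun_prop]
lemma contDiffAt_matrix_inv {f : E → Matrix (Fin a) (Fin a) ℝ} {z : E}
    (hf : ContDiffAt ℝ 1 f z) (h : (f z).det ≠ 0) : ContDiffAt ℝ 1 (fun w => (f w)⁻¹) z := by
  simp only [Matrix.inv_def, Ring.inverse_eq_inv']
  refine ((contDiffAt_matrix_det hf).inv h).smul (contDiffAt_matrix.2 fun i j => ?_)
  simp only [Matrix.adjugate_apply]
  refine contDiffAt_matrix_det (contDiffAt_matrix.2 fun k l => ?_)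
  simp only [Matrix.updateRow_apply]
  split_ifs
  · exact contDiffAt_const
  · exact contDiffAt_matrix.1 hf k l

lemma hasDerivWithinAt_transpose {f : ℝ → Matrix (Fin a) (Fin b) ℝ} {f' : Matrix (Fin a) (Fin b) ℝ}
    {s : Set ℝ} {t : ℝ} (h : HasDerivWithinAt f f' s t) :
    HasDerivWithinAt (fun u => (f u)ᵀ) f'ᵀ s t :=
  hasDerivWithinAt_matrix.2 fun i j => hasDerivWithinAt_matrix.1 h j i

/-- The Frobenius norm is dominated by the sup norm. -/
lemma frob_le_card_mul_norm (M : Matrix (Fin a) (Fin b) ℝ) :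
    frob M ≤ (a * b : ℝ) * ‖M‖ := by
  refine Real.sqrt_le_iff.2 ⟨by positivity, ?_⟩
  have h1 : ∑ i, ∑ j, (M i j) ^ 2 ≤ (a * b : ℝ) * ‖M‖ ^ 2 := by
    calc ∑ i, ∑ j, (M i j) ^ 2 ≤ ∑ _i : Fin a, ∑ _j : Fin b, ‖M‖ ^ 2 := by
          refine Finset.sum_le_sum fun i _ => Finset.sum_le_sum fun j _ => ?_
          rw [← sq_abs (M i j), ← Real.norm_eq_abs]
          exact pow_le_pow_left₀ (norm_nonneg _) (Matrix.norm_entry_le_entrywise_sup_norm M) 2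
      _ = (a * b : ℝ) * ‖M‖ ^ 2 := by simp [mul_assoc]
  refine h1.trans ?_
  rw [mul_pow]
  gcongr
  rcases Nat.eq_zero_or_pos (a * b) with h | h
  · have : (a * b : ℝ) = 0 := by exact_mod_cast h
    simp [this]
  · have : (1 : ℝ) ≤ a * b := by exact_mod_cast h
    nlinarith

end MatrixCalculus

section Systems

attribute [local instance] Matrix.normedAddCommGroup Matrix.normedSpace

variable {n n₁ : ℕ} (p : Params n n₁)

/-- State space of the rescaled system: `(Λ₁, Λ₂, S)`. -/
abbrev RescaledState (n : ℕ) : Type :=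
  Matrix (Fin n) (Fin n) ℝ × Matrix (Fin n) (Fin n) ℝ × Matrix (Fin n) (Fin 1) ℝ

/-- `N E^N` as a function of the real parameter `ε = 1 / N`. -/
noncomputable def invGap (ε : ℝ) (Λ₁ Λ₂ : Matrix (Fin n) (Fin n) ℝ) :
    Matrix (Fin n₁) (Fin n₁) ℝ :=
  (p.R2 Λ₁ Λ₂ - ε • (p.B0ᵀ * Λ₂ * p.B0))⁻¹ - (p.R1 Λ₁)⁻¹

/-- The perturbation `g₁` as a function of the real parameter `ε = 1 / N`. -/
noncomputable def g₁Real (ε : ℝ) (Λ₁ Λ₂ : Matrix (Fin n) (Fin n) ℝ) :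
    Matrix (Fin n) (Fin n) ℝ :=
  Λ₁ * p.B * (ε • invGap p ε Λ₁ Λ₂) * p.Bᵀ * Λ₁
  + (1 - ε) • (Λ₂ * p.B * (ε • invGap p ε Λ₁ Λ₂) * p.Bᵀ * Λ₁
      + Λ₁ * p.B * (ε • invGap p ε Λ₁ Λ₂) * p.Bᵀ * Λ₂)
  + (ε - ε ^ 2) •
      (Λ₂ * p.B * ((ε • invGap p ε Λ₁ Λ₂ + (p.R1 Λ₁)⁻¹) + (1 - 2 * ε) • invGap p ε Λ₁ Λ₂)
        * p.Bᵀ * Λ₂)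
  - ε • ((Λ₁ * p.G + p.Gᵀ * Λ₁) + (1 - ε) • (Λ₂ * p.G + p.Gᵀ * Λ₂))
  - ε • p.QΓ

/-- The perturbation `g₂` as a function of the real parameter `ε = 1 / N`. -/
noncomputable def g₂Real (ε : ℝ) (Λ₁ Λ₂ : Matrix (Fin n) (Fin n) ℝ) :
    Matrix (Fin n) (Fin n) ℝ :=
  (Λ₁ + Λ₂) * p.B *
      (invGap p ε Λ₁ Λ₂ + (p.R1 Λ₁)⁻¹ - (p.R2 Λ₁ Λ₂)⁻¹) * p.Bᵀ * (Λ₁ + Λ₂)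
  - (2 * ε) • (Λ₂ * p.B * (p.R1 Λ₁)⁻¹ * p.Bᵀ * Λ₂)
  + (ε - 2) • (Λ₂ * p.B * (ε • invGap p ε Λ₁ Λ₂) * p.Bᵀ * Λ₂)
  - Λ₁ * p.B * (ε • invGap p ε Λ₁ Λ₂) * p.Bᵀ * Λ₂
  - Λ₂ * p.B * (ε • invGap p ε Λ₁ Λ₂) * p.Bᵀ * Λ₁
  + ε • (Λ₂ * p.G + p.Gᵀ * Λ₂)

/-- The perturbation `g₀₁` as a function of the real parameter `ε = 1 / N`. -/
noncomputable def g01Real (ε : ℝ) (Λ₁ Λ₂ : Matrix (Fin n) (Fin n) ℝ)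
    (S : Matrix (Fin n) (Fin 1) ℝ) : Matrix (Fin n) (Fin 1) ℝ :=
  (Λ₁ + (1 - ε) • Λ₂) * p.B * (p.R2 Λ₁ Λ₂ - ε • (p.B0ᵀ * Λ₂ * p.B0))⁻¹ *
      (p.Bᵀ * S + p.B1ᵀ * Λ₁ * p.D + p.B0ᵀ * (Λ₁ + (1 - ε) • Λ₂) * p.D0)
  - (Λ₁ + Λ₂) * p.B * (p.R2 Λ₁ Λ₂)⁻¹ *
      (p.Bᵀ * S + p.B1ᵀ * Λ₁ * p.D + p.B0ᵀ * (Λ₁ + Λ₂) * p.D0)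

/-- The right-hand side of the rescaled system, with parameter `ε = 1 / N`. -/
noncomputable def rescaledField (z : ℝ × RescaledState n) : RescaledState n :=
  (p.Ψ₁ z.2.1 + g₁Real p z.1 z.2.1 z.2.2.1,
   p.Ψ₂ z.2.1 z.2.2.1 + g₂Real p z.1 z.2.1 z.2.2.1,
   p.φ₁ z.2.1 z.2.2.1 z.2.2.2 + g01Real p z.1 z.2.1 z.2.2.1 z.2.2.2)

lemma g₁_eq_g₁Real {N : ℕ} (hN : 1 ≤ N) (Λ₁ Λ₂ : Matrix (Fin n) (Fin n) ℝ) :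
    p.g₁ N Λ₁ Λ₂ = g₁Real p (1 / (N : ℝ)) Λ₁ Λ₂ := by
  have hN0 : (N : ℝ) ≠ 0 := by positivity
  have h : ((N : ℝ) - 2) * (1 / (N : ℝ)) = 1 - 2 * (1 / (N : ℝ)) := by field_simp
  have h2 : 1 / (N : ℝ) ^ 2 = (1 / (N : ℝ)) ^ 2 := by ring
  simp only [Params.g₁, g₁Real, Params.EN, Params.HN, invGap, smul_smul, h, h2]

lemma g₂_eq_g₂Real {N : ℕ} (hN : 1 ≤ N) (Λ₁ Λ₂ : Matrix (Fin n) (Fin n) ℝ) :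
    p.g₂ N Λ₁ Λ₂ = g₂Real p (1 / (N : ℝ)) Λ₁ Λ₂ := by
  have hN0 : (N : ℝ) ≠ 0 := by positivity
  have h : (N : ℝ) * (1 / (N : ℝ)) = 1 := by field_simp
  have h2 : 2 / (N : ℝ) = 2 * (1 / (N : ℝ)) := by ring
  simp only [Params.g₂, g₂Real, Params.EN, invGap, smul_smul, h, h2, one_smul]

lemma g01_eq_g01Real (N : ℕ) (Λ₁ Λ₂ : Matrix (Fin n) (Fin n) ℝ)
    (S : Matrix (Fin n) (Fin 1) ℝ) :
    p.g01 N Λ₁ Λ₂ S = g01Real p (1 / (N : ℝ)) Λ₁ Λ₂ S := rfl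

lemma rescaledField_zero (Λ₁ Λ₂ : Matrix (Fin n) (Fin n) ℝ) (S : Matrix (Fin n) (Fin 1) ℝ) :
    rescaledField p (0, Λ₁, Λ₂, S) = (p.Ψ₁ Λ₁, p.Ψ₂ Λ₁ Λ₂, p.φ₁ Λ₁ Λ₂ S) := by
  simp [rescaledField, g₁Real, g₂Real, g01Real, invGap]

lemma contDiffAt_rescaledField {Λ₁ Λ₂ : Matrix (Fin n) (Fin n) ℝ}
    (S : Matrix (Fin n) (Fin 1) ℝ) (h₁ : (p.R1 Λ₁).det ≠ 0) (h₂ : (p.R2 Λ₁ Λ₂).det ≠ 0) :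
    ContDiffAt ℝ 1 (rescaledField p) (0, Λ₁, Λ₂, S) := by
  have hR1 : ContDiffAt ℝ 1 (fun z : ℝ × RescaledState n => (p.R1 z.2.1)⁻¹)
      (0, Λ₁, Λ₂, S) := by
    refine contDiffAt_matrix_inv ?_ h₁
    unfold Params.R1
    fun_prop
  have hR2 : ContDiffAt ℝ 1 (fun z : ℝ × RescaledState n => (p.R2 z.2.1 z.2.2.1)⁻¹)
      (0, Λ₁, Λ₂, S) := by
    refine contDiffAt_matrix_inv ?_ h₂
    unfold Params.R2
    fun_prop
  have hR3 : ContDiffAt ℝ 1 (fun z : ℝ × RescaledState n =>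
      (p.R2 z.2.1 z.2.2.1 - z.1 • (p.B0ᵀ * z.2.2.1 * p.B0))⁻¹) (0, Λ₁, Λ₂, S) := by
    refine contDiffAt_matrix_inv ?_ (by simpa using h₂)
    unfold Params.R2
    fun_prop
  have hgap : ContDiffAt ℝ 1 (fun z : ℝ × RescaledState n => invGap p z.1 z.2.1 z.2.2.1)
      (0, Λ₁, Λ₂, S) := hR3.sub hR1
  unfold rescaledField Params.Ψ₁ Params.Ψ₂ Params.φ₁ g₁Real g₂Real g01Real
  fun_prop

/-- `S^N` is `O(1 / N)`-close to `S`. -/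
theorem rescaled_close (Λ₁ Λ₂ : ℝ → Matrix (Fin n) (Fin n) ℝ)
    (S : ℝ → Matrix (Fin n) (Fin 1) ℝ) (r : ℝ → ℝ)
    (hLim : p.IsSolLim Λ₁ Λ₂) (hSr : p.IsSolSr Λ₁ Λ₂ S r) :
    ∃ N₁ : ℕ, 1 ≤ N₁ ∧ ∃ C : ℝ, 0 < C ∧ ∀ N : ℕ, N₁ ≤ N →
      ∀ (Λ₁N Λ₂N : ℝ → Matrix (Fin n) (Fin n) ℝ)
        (SN : ℝ → Matrix (Fin n) (Fin 1) ℝ) (rN : ℝ → ℝ),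
        p.IsSolLamN N Λ₁N Λ₂N → p.IsSolSrN N Λ₁N Λ₂N SN rN →
        ∀ t ∈ Icc (0 : ℝ) p.T, ‖SN t - S t‖ ≤ C / (N : ℝ) := by
  obtain ⟨-, hpos, hT1, hT2, hd1, hd2⟩ := hLim
  obtain ⟨hST, -, hdS, -⟩ := hSr
  obtain ⟨N₁, hN₁, C, hC, h⟩ := terminal_value_perturbation (T := p.T) (rescaledField p)
    (fun t => (Λ₁ t, Λ₂ t, S t))
    (fun t ht => by
      rw [rescaledField_zero]
      exact (hasDerivWithinAt_matrix.2 (hd1 t ht)).prodMk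
        ((hasDerivWithinAt_matrix.2 (hd2 t ht)).prodMk (hasDerivWithinAt_matrix.2 (hdS t ht))))
    (fun t ht => contDiffAt_rescaledField p _ (hpos t ht).1.det_pos.ne' (hpos t ht).2.det_pos.ne')
    ‖p.QfΓ‖
  refine ⟨N₁, hN₁, C, hC, fun N hN Λ₁N Λ₂N SN rN hΛ hS t ht => ?_⟩
  obtain ⟨-, -, hT1', hT2', hd1', hd2'⟩ := hΛ
  obtain ⟨hST', -, hdS', -⟩ := hS
  have hN1 : 1 ≤ N := hN₁.trans hN
  have := h N hN (fun t => (Λ₁N t, Λ₂N t, SN t)) (fun t ht => by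
      have := (hasDerivWithinAt_matrix.2 (hd1' t ht)).prodMk
        ((hasDerivWithinAt_matrix.2 (hd2' t ht)).prodMk (hasDerivWithinAt_matrix.2 (hdS' t ht)))
      rw [g₁_eq_g₁Real p hN1, g₂_eq_g₂Real p hN1, g01_eq_g01Real] at this
      exact this)
    (by
      simp only [hT1, hT2, hST, hT1', hT2', hST', Prod.mk_sub_mk, Prod.norm_mk, sub_self,
        add_sub_cancel_left, norm_zero, norm_smul]
      have h0 : 0 ≤ ‖p.QfΓ‖ := norm_nonneg _
      rw [max_eq_left (by positivity)]
      simp [div_eq_inv_mul]) t ht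
  refine le_trans ?_ this
  exact (norm_snd_le (((Λ₁N t, Λ₂N t, SN t) : RescaledState n) - (Λ₁ t, Λ₂ t, S t)).2).trans
    (norm_snd_le (((Λ₁N t, Λ₂N t, SN t) : RescaledState n) - (Λ₁ t, Λ₂ t, S t)))

/-- State space for the decentralized coefficients in the combined variables
`(Λ̌₁, Λ̌₂ / N, Λ̌₂ - Λ̌₂ᵀ, Λ̌₁ + Λ̌₂ + Λ̌₁₂, Λ̌₁₂ᵀ + Λ̌₂₂, Š₁, Š₂)`. -/
abbrev CheckState (n : ℕ) : Type :=
  Matrix (Fin n) (Fin n) ℝ × Matrix (Fin n) (Fin n) ℝ × Matrix (Fin n) (Fin n) ℝ ×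
    Matrix (Fin n) (Fin n) ℝ × Matrix (Fin n) (Fin n) ℝ ×
    Matrix (Fin n) (Fin 1) ℝ × Matrix (Fin n) (Fin 1) ℝ

/-- `R + B₁ᵀ L B₁ + B₀ᵀ M B₀`. -/
noncomputable def controlWeight (L M : Matrix (Fin n) (Fin n) ℝ) : Matrix (Fin n₁) (Fin n₁) ℝ :=
  p.R + p.B1ᵀ * L * p.B1 + p.B0ᵀ * M * p.B0

/-- Defect in the stationarity condition defining `Θ + Θ₁`. -/
noncomputable def gainDefect (K : Matrix (Fin n₁) (Fin n) ℝ) (L M : Matrix (Fin n) (Fin n) ℝ) :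
    Matrix (Fin n₁) (Fin n) ℝ :=
  controlWeight p L M * K - p.Bᵀ * M

/-- Defect in the stationarity condition defining `Θ₂`. -/
noncomputable def offsetDefect (Θ₂ : Matrix (Fin n₁) (Fin 1) ℝ) (L M : Matrix (Fin n) (Fin n) ℝ)
    (s : Matrix (Fin n) (Fin 1) ℝ) : Matrix (Fin n₁) (Fin 1) ℝ :=
  controlWeight p L M * Θ₂ - p.Bᵀ * s - p.B1ᵀ * L * p.D - p.B0ᵀ * M * p.D0

/-- The linear right-hand side satisfied by the combined decentralized coefficients. -/
noncomputable def checkCoeffField (ε : ℝ) (Θ Θ₁ : Matrix (Fin n₁) (Fin n) ℝ)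
    (Θ₂ : Matrix (Fin n₁) (Fin 1) ℝ) (L V U M W : Matrix (Fin n) (Fin n) ℝ)
    (s₁ s₂ : Matrix (Fin n) (Fin 1) ℝ) : CheckState n :=
  (-(Θᵀ * p.R1 L * Θ + L * (p.A - p.B * Θ) + (p.A - p.B * Θ)ᵀ * L + p.Q
      + ε • (Θᵀ * p.B0ᵀ * L * p.B0 * Θ + L * p.G + p.Gᵀ * L + p.QΓ)
      + (1 - ε) • (Θᵀ * p.B0ᵀ * V * p.B0 * Θ + V * p.G + p.Gᵀ * V)),
   -(ε • (Θᵀ * p.B0ᵀ * L * p.B0 * Θ + L * p.G + p.Gᵀ * L + p.QΓ)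
      + Θᵀ * p.B0ᵀ * V * p.B0 * Θ
      + V * (p.A + p.G - p.B * Θ) + (p.A + p.G - p.B * Θ)ᵀ * V
      - ε • (Θᵀ * p.B0ᵀ * V * p.B0 * Θ + V * p.G + p.Gᵀ * V)),
   -(Θᵀ * p.B0ᵀ * (L - Lᵀ + U) * p.B0 * Θ + (L - Lᵀ) * p.G + p.Gᵀ * (L - Lᵀ)
      + U * (p.A + p.G - p.B * Θ) + (p.A + p.G - p.B * Θ)ᵀ * U
      - ε • (Θᵀ * p.B0ᵀ * U * p.B0 * Θ + U * p.G + p.Gᵀ * U)),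
   -(Θᵀ * gainDefect p (Θ + Θ₁) L M + M * (p.A + p.G - p.B * (Θ + Θ₁)) + (p.A + p.G)ᵀ * M
      + p.Q + p.QΓ
      + ε • (Θᵀ * p.B0ᵀ * L * p.B0 * Θ + L * p.G + p.Gᵀ * L + p.QΓ)
      - ε • (Θᵀ * p.B0ᵀ * V * p.B0 * Θ + V * p.G + p.Gᵀ * V)
      - Θᵀ * p.B0ᵀ * V * p.B0 * Θ₁ + V * p.B * Θ₁),
   -(Θ₁ᵀ * gainDefect p (Θ + Θ₁) L M
      - Θ₁ᵀ * (p.B1ᵀ * (L - Lᵀ) * p.B1 + p.B0ᵀ * (L - Lᵀ + U) * p.B0) * Θ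
      + Θ₁ᵀ * p.Bᵀ * (L - Lᵀ + U)
      + (Θ + Θ₁)ᵀ * p.B0ᵀ * W * p.B0 * (Θ + Θ₁)
      + W * (p.A + p.G - p.B * (Θ + Θ₁)) + (p.A + p.G - p.B * (Θ + Θ₁))ᵀ * W
      - Θ₁ᵀ * p.B0ᵀ * Vᵀ * p.B0 * Θ + Θ₁ᵀ * p.Bᵀ * Vᵀ
      - Θ₁ᵀ * p.B0ᵀ * V * p.B0 * Θ₁),
   -(Θᵀ * offsetDefect p Θ₂ L M s₁ - M * p.B * Θ₂ + (p.A + p.G)ᵀ * s₁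
      + Θᵀ * p.B0ᵀ * V * (p.D0 - p.B0 * Θ₂) + V * p.B * Θ₂),
   -(Θ₁ᵀ * offsetDefect p Θ₂ L M s₁ + (p.A + p.G - p.B * (Θ + Θ₁))ᵀ * s₂
      - (Θ + Θ₁)ᵀ * p.B0ᵀ * W * (p.D0 - p.B0 * Θ₂) - W * p.B * Θ₂
      - Θ₁ᵀ * p.B0ᵀ * V * p.B0 * Θ₂ + Θ₁ᵀ * p.B0ᵀ * V * p.D0))

lemma QΓ_transpose (hQ : p.Q.IsSymm) : p.QΓᵀ = p.QΓ := by
  simp only [Params.QΓ, Matrix.transpose_sub, Matrix.transpose_mul, Matrix.transpose_transpose,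
    hQ.eq, Matrix.mul_assoc]
  abel

lemma QfΓ_transpose (hQ : p.Qf.IsSymm) : p.QfΓᵀ = p.QfΓ := by
  simp only [Params.QfΓ, Matrix.transpose_sub, Matrix.transpose_mul, Matrix.transpose_transpose,
    hQ.eq, Matrix.mul_assoc]
  abel

section Identities

variable (N : ℕ) (Θ Θ₁ : Matrix (Fin n₁) (Fin n) ℝ) (Θ₂ : Matrix (Fin n₁) (Fin 1) ℝ)
  (L1 L2 L12 L22 : Matrix (Fin n) (Fin n) ℝ) (S1 S2 : Matrix (Fin n) (Fin 1) ℝ)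

/-- The decentralized coefficients satisfy a closed linear system in the combined variables. -/
lemma checkCoeffField_eq (hQ : p.Q.IsSymm) (hR : p.R.IsSymm) :
    checkCoeffField p (1 / (N : ℝ)) Θ Θ₁ Θ₂ L1 ((1 / (N : ℝ)) • L2) (L2 - L2ᵀ)
        (L1 + L2 + L12) (L12ᵀ + L22) S1 S2 =
      (-p.check1RHS N Θ L1 L2,
       (1 / (N : ℝ)) • (-p.check2RHS N Θ L1 L2),
       -p.check2RHS N Θ L1 L2 - (-p.check2RHS N Θ L1 L2)ᵀ,
       -p.check1RHS N Θ L1 L2 + -p.check2RHS N Θ L1 L2 + -p.check12RHS N Θ Θ₁ L1 L2 L12,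
       (-p.check12RHS N Θ Θ₁ L1 L2 L12)ᵀ
        + -p.check22RHS N Θ₁ (-(p.B0 * (Θ + Θ₁))) (p.A + p.G - p.B * (Θ + Θ₁)) L1 L2 L12 L22,
       -p.checkS1RHS N Θ Θ₂ L1 L2 L12 S1,
       -p.checkS2RHS N Θ₁ Θ₂ (-(p.B0 * (Θ + Θ₁))) (p.A + p.G - p.B * (Θ + Θ₁))
          L1 L2 L12 L22 S1 S2) := by
  have hQΓ := QΓ_transpose p hQ
  refine Prod.ext ?_ (Prod.ext ?_ (Prod.ext ?_ (Prod.ext ?_ (Prod.ext ?_ (Prod.ext ?_ ?_)))))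
  all_goals
    simp only [checkCoeffField, gainDefect, offsetDefect, controlWeight, Params.check1RHS,
      Params.check2RHS, Params.check12RHS, Params.check22RHS, Params.checkS1RHS,
      Params.checkS2RHS, Params.gc1, Params.gc2, Params.gc12, Params.gc22, Params.gc01,
      Params.gc02, Params.R1, Params.R2,
      Matrix.transpose_add, Matrix.transpose_sub, Matrix.transpose_neg, Matrix.transpose_smul,
      Matrix.transpose_mul, Matrix.transpose_transpose, hQΓ, hR.eq,
      Matrix.mul_add, Matrix.add_mul, Matrix.mul_sub, Matrix.sub_mul, Matrix.mul_neg,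
      Matrix.neg_mul, Matrix.mul_smul, Matrix.smul_mul, Matrix.mul_assoc]
    module

end Identities

lemma theta_add_theta1 (Λ₁ Λ₂ : Matrix (Fin n) (Fin n) ℝ) :
    p.Theta Λ₁ + p.Theta1 Λ₁ Λ₂ = (p.R2 Λ₁ Λ₂)⁻¹ * p.Bᵀ * (Λ₁ + Λ₂) := by
  simp only [Params.Theta, Params.Theta1, Matrix.mul_add, Matrix.sub_mul]
  abel

lemma gainDefect_limit {Λ₁ Λ₂ : Matrix (Fin n) (Fin n) ℝ} (h₂ : (p.R2 Λ₁ Λ₂).det ≠ 0) :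
    gainDefect p (p.Theta Λ₁ + p.Theta1 Λ₁ Λ₂) Λ₁ (Λ₁ + Λ₂) = 0 := by
  have hu : IsUnit (p.R2 Λ₁ Λ₂).det := h₂.isUnit
  have hw : controlWeight p Λ₁ (Λ₁ + Λ₂) = p.R2 Λ₁ Λ₂ := rfl
  rw [gainDefect, theta_add_theta1, hw, Matrix.mul_assoc, Matrix.mul_nonsing_inv_cancel_left _ _ hu,
    sub_self]

lemma offsetDefect_limit {Λ₁ Λ₂ : Matrix (Fin n) (Fin n) ℝ} (S : Matrix (Fin n) (Fin 1) ℝ)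
    (h₂ : (p.R2 Λ₁ Λ₂).det ≠ 0) :
    offsetDefect p (p.Theta2 Λ₁ Λ₂ S) Λ₁ (Λ₁ + Λ₂) S = 0 := by
  have hu : IsUnit (p.R2 Λ₁ Λ₂).det := h₂.isUnit
  have hw : controlWeight p Λ₁ (Λ₁ + Λ₂) = p.R2 Λ₁ Λ₂ := rfl
  rw [offsetDefect, hw, Params.Theta2, Matrix.mul_nonsing_inv_cancel_left _ _ hu]
  abel

lemma checkCoeffField_limit {Λ₁ Λ₂ : Matrix (Fin n) (Fin n) ℝ} (S : Matrix (Fin n) (Fin 1) ℝ)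
    (hs : Λ₁.IsSymm) (h₁ : (p.R1 Λ₁).det ≠ 0) (h₂ : (p.R2 Λ₁ Λ₂).det ≠ 0) :
    checkCoeffField p 0 (p.Theta Λ₁) (p.Theta1 Λ₁ Λ₂) (p.Theta2 Λ₁ Λ₂ S)
        Λ₁ 0 0 (Λ₁ + Λ₂) 0 S 0 =
      (p.Ψ₁ Λ₁, 0, 0, p.Ψ₁ Λ₁ + p.Ψ₂ Λ₁ Λ₂, 0, p.φ₁ Λ₁ Λ₂ S, 0) := by
  have hu : IsUnit (p.R1 Λ₁).det := h₁.isUnit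
  have hΘ : p.R1 Λ₁ * p.Theta Λ₁ = p.Bᵀ * Λ₁ := by
    rw [Params.Theta, Matrix.mul_assoc, Matrix.mul_nonsing_inv_cancel_left _ _ hu]
  refine Prod.ext ?_ (Prod.ext ?_ (Prod.ext ?_ (Prod.ext ?_ (Prod.ext ?_ (Prod.ext ?_ ?_)))))
  · have h : Λ₁ * (p.B * p.Theta Λ₁) = Λ₁ * p.B * (p.R1 Λ₁)⁻¹ * p.Bᵀ * Λ₁ := by
      simp only [Params.Theta, Matrix.mul_assoc]
    simp only [checkCoeffField, Params.Ψ₁, Matrix.mul_assoc _ _ (p.Theta Λ₁), hΘ, Matrix.mul_sub,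
      h, Matrix.transpose_sub, Matrix.transpose_mul, Matrix.sub_mul, Matrix.mul_zero,
      Matrix.zero_mul, smul_zero, zero_smul, add_zero, Matrix.mul_assoc (p.Theta Λ₁)ᵀ]
    abel
  · simp [checkCoeffField]
  · simp [checkCoeffField, hs.eq]
  · have h : (Λ₁ + Λ₂) * (p.B * (p.Theta Λ₁ + p.Theta1 Λ₁ Λ₂))
        = (Λ₁ + Λ₂) * p.B * (p.R2 Λ₁ Λ₂)⁻¹ * p.Bᵀ * (Λ₁ + Λ₂) := by
      rw [theta_add_theta1]; simp only [Matrix.mul_assoc]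
    simp only [checkCoeffField, Params.Ψ₁, Params.Ψ₂, gainDefect_limit p h₂, Matrix.mul_sub _ _
      (p.B * (p.Theta Λ₁ + p.Theta1 Λ₁ Λ₂)), h, Matrix.mul_zero, Matrix.zero_mul, zero_smul,
      Matrix.transpose_add]
    simp only [Matrix.mul_add _ p.A p.G, Matrix.add_mul _ _ p.A, Matrix.add_mul _ _ p.G,
      Matrix.add_mul p.Aᵀ, Matrix.mul_add p.Aᵀ, Matrix.mul_add p.Gᵀ]
    abel
  · simp [checkCoeffField, gainDefect_limit p h₂, hs.eq]
  · simp only [checkCoeffField, offsetDefect_limit p S h₂, Matrix.mul_zero, Matrix.zero_mul]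
    simp only [Params.φ₁, Params.Theta2, Matrix.mul_assoc]
    abel
  · simp [checkCoeffField, offsetDefect_limit p S h₂]

/-- The right-hand side of the limiting system coupled with the decentralized coefficients. -/
noncomputable def checkField (z : ℝ × RescaledState n × CheckState n) :
    RescaledState n × CheckState n :=
  ((p.Ψ₁ z.2.1.1, p.Ψ₂ z.2.1.1 z.2.1.2.1, p.φ₁ z.2.1.1 z.2.1.2.1 z.2.1.2.2),
   checkCoeffField p z.1 (p.Theta z.2.1.1) (p.Theta1 z.2.1.1 z.2.1.2.1)
    (p.Theta2 z.2.1.1 z.2.1.2.1 z.2.1.2.2) z.2.2.1 z.2.2.2.1 z.2.2.2.2.1 z.2.2.2.2.2.1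
    z.2.2.2.2.2.2.1 z.2.2.2.2.2.2.2.1 z.2.2.2.2.2.2.2.2)

lemma contDiffAt_checkField {Λ₁ Λ₂ : Matrix (Fin n) (Fin n) ℝ} (S : Matrix (Fin n) (Fin 1) ℝ)
    (w : CheckState n) (h₁ : (p.R1 Λ₁).det ≠ 0) (h₂ : (p.R2 Λ₁ Λ₂).det ≠ 0) :
    ContDiffAt ℝ 1 (checkField p) (0, (Λ₁, Λ₂, S), w) := by
  have hR1 : ContDiffAt ℝ 1 (fun z : ℝ × RescaledState n × CheckState n => (p.R1 z.2.1.1)⁻¹)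
      (0, (Λ₁, Λ₂, S), w) := by
    refine contDiffAt_matrix_inv ?_ h₁
    unfold Params.R1
    fun_prop
  have hR2 : ContDiffAt ℝ 1 (fun z : ℝ × RescaledState n × CheckState n =>
      (p.R2 z.2.1.1 z.2.1.2.1)⁻¹) (0, (Λ₁, Λ₂, S), w) := by
    refine contDiffAt_matrix_inv ?_ h₂
    unfold Params.R2
    fun_prop
  have hΘ : ContDiffAt ℝ 1 (fun z : ℝ × RescaledState n × CheckState n => p.Theta z.2.1.1)
      (0, (Λ₁, Λ₂, S), w) := by
    unfold Params.Theta
    fun_prop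
  have hΘ₁ : ContDiffAt ℝ 1 (fun z : ℝ × RescaledState n × CheckState n =>
      p.Theta1 z.2.1.1 z.2.1.2.1) (0, (Λ₁, Λ₂, S), w) := by
    unfold Params.Theta1
    fun_prop
  have hΘ₂ : ContDiffAt ℝ 1 (fun z : ℝ × RescaledState n × CheckState n =>
      p.Theta2 z.2.1.1 z.2.1.2.1 z.2.1.2.2) (0, (Λ₁, Λ₂, S), w) := by
    unfold Params.Theta2
    fun_prop
  unfold checkField
  refine ContDiffAt.prodMk ?_ ?_
  · unfold Params.Ψ₁ Params.Ψ₂ Params.φ₁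
    fun_prop
  · unfold checkCoeffField gainDefect offsetDefect controlWeight
    unfold Params.R1
    fun_prop

/-- `Š₁^N` is `O(1 / N)`-close to `S`, and `Š₂^N` is `O(1 / N)`. -/
theorem check_close (hp : p.Standing) (Λ₁ Λ₂ : ℝ → Matrix (Fin n) (Fin n) ℝ)
    (S : ℝ → Matrix (Fin n) (Fin 1) ℝ) (r : ℝ → ℝ)
    (hLim : p.IsSolLim Λ₁ Λ₂) (hSr : p.IsSolSr Λ₁ Λ₂ S r) :
    ∃ N₁ : ℕ, 1 ≤ N₁ ∧ ∃ C : ℝ, 0 < C ∧ ∀ N : ℕ, N₁ ≤ N →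
      ∀ (L1 L2 L12 L22 : ℝ → Matrix (Fin n) (Fin n) ℝ)
        (S1 S2 : ℝ → Matrix (Fin n) (Fin 1) ℝ),
        p.IsSolCheckC N Λ₁ Λ₂ S L1 L2 L12 L22 S1 S2 →
        ∀ t ∈ Icc (0 : ℝ) p.T, ‖S1 t - S t‖ ≤ C / (N : ℝ) ∧ ‖S2 t‖ ≤ C / (N : ℝ) := by
  obtain ⟨-, -, -, hQ, hQf, hR⟩ := hp
  obtain ⟨hsymm, hpos, hT1, hT2, hd1, hd2⟩ := hLim
  obtain ⟨hST, -, hdS, -⟩ := hSr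
  have hd : ∀ t ∈ Icc (0 : ℝ) p.T, HasDerivWithinAt (fun t => ((Λ₁ t, Λ₂ t, S t) : RescaledState n))
      (p.Ψ₁ (Λ₁ t), p.Ψ₂ (Λ₁ t) (Λ₂ t), p.φ₁ (Λ₁ t) (Λ₂ t) (S t)) (Icc 0 p.T) t := fun t ht =>
    (hasDerivWithinAt_matrix.2 (hd1 t ht)).prodMk
      ((hasDerivWithinAt_matrix.2 (hd2 t ht)).prodMk (hasDerivWithinAt_matrix.2 (hdS t ht)))
  have hdet1 : ∀ t ∈ Icc (0 : ℝ) p.T, (p.R1 (Λ₁ t)).det ≠ 0 := fun t ht => (hpos t ht).1.det_pos.ne'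
  have hdet2 : ∀ t ∈ Icc (0 : ℝ) p.T, (p.R2 (Λ₁ t) (Λ₂ t)).det ≠ 0 :=
    fun t ht => (hpos t ht).2.det_pos.ne'
  obtain ⟨N₁, hN₁, C, hC, h⟩ := terminal_value_perturbation (T := p.T) (checkField p)
    (fun t => ((Λ₁ t, Λ₂ t, S t), (Λ₁ t, 0, 0, Λ₁ t + Λ₂ t, 0, S t, 0)))
    (fun t ht => by
      have e1 := hasDerivWithinAt_matrix.2 (hd1 t ht)
      have e2 := hasDerivWithinAt_matrix.2 (hd2 t ht)
      have eS := hasDerivWithinAt_matrix.2 (hdS t ht)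
      have hz : HasDerivWithinAt (fun _ : ℝ => (0 : Matrix (Fin n) (Fin n) ℝ)) 0 (Icc 0 p.T) t :=
        hasDerivWithinAt_const _ _ _
      have hz' : HasDerivWithinAt (fun _ : ℝ => (0 : Matrix (Fin n) (Fin 1) ℝ)) 0 (Icc 0 p.T) t :=
        hasDerivWithinAt_const _ _ _
      have := (hd t ht).prodMk (e1.prodMk (hz.prodMk (hz.prodMk ((e1.add e2).prodMk
        (hz.prodMk (eS.prodMk hz'))))))
      refine this.congr_deriv ?_
      rw [checkField, checkCoeffField_limit p (S t) (hsymm t ht).1 (hdet1 t ht) (hdet2 t ht)])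
    (fun t ht => contDiffAt_checkField p _ _ (hdet1 t ht) (hdet2 t ht))
    ‖p.QfΓ‖
  refine ⟨N₁, hN₁, C, hC, fun N hN L1 L2 L12 L22 S1 S2 hsol t ht => ?_⟩
  obtain ⟨⟨⟨hTL1, hTL2, hdL1, hdL2⟩, hTL12, hTL22, hdL12, hdL22⟩, hTS1, hTS2, hdS1, hdS2⟩ := hsol
  have key := h N hN (fun t => ((Λ₁ t, Λ₂ t, S t),
      (L1 t, (1 / (N : ℝ)) • L2 t, L2 t - (L2 t)ᵀ, L1 t + L2 t + L12 t, (L12 t)ᵀ + L22 t,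
        S1 t, S2 t)))
    (fun t ht => by
      have e1 := hasDerivWithinAt_matrix.2 (hdL1 t ht)
      have e2 := hasDerivWithinAt_matrix.2 (hdL2 t ht)
      have e12 := hasDerivWithinAt_matrix.2 (hdL12 t ht)
      have e22 := hasDerivWithinAt_matrix.2 (hdL22 t ht)
      have f1 := hasDerivWithinAt_matrix.2 (hdS1 t ht)
      have f2 := hasDerivWithinAt_matrix.2 (hdS2 t ht)
      have := (hd t ht).prodMk (e1.prodMk ((e2.const_smul (1 / (N : ℝ))).prodMk
        ((e2.sub (hasDerivWithinAt_transpose e2)).prodMk (((e1.add e2).add e12).prodMk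
        (((hasDerivWithinAt_transpose e12).add e22).prodMk (f1.prodMk f2))))))
      refine this.congr_deriv ?_
      rw [checkField, checkCoeffField_eq p N _ _ _ _ _ _ _ _ _ hQ hR]
      rfl)
    (by
      simp only [hT1, hT2, hST, hTL1, hTL2, hTL12, hTL22, hTS1, hTS2, QfΓ_transpose p hQf,
        Prod.mk_sub_mk, Prod.norm_mk, sub_self, Matrix.transpose_zero, add_zero, sub_zero,
        norm_zero, add_sub_cancel_left, add_sub_add_right_eq_sub, norm_smul]
      have hε : ‖1 / (N : ℝ)‖ * ‖p.QfΓ‖ = ‖p.QfΓ‖ / N := by simp [div_eq_inv_mul]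
      have h0 : 0 ≤ ‖p.QfΓ‖ / N := by positivity
      rw [hε]
      simp [h0]) t ht
  set d : RescaledState n × CheckState n := ((Λ₁ t, Λ₂ t, S t),
      (L1 t, (1 / (N : ℝ)) • L2 t, L2 t - (L2 t)ᵀ, L1 t + L2 t + L12 t, (L12 t)ᵀ + L22 t,
        S1 t, S2 t)) - ((Λ₁ t, Λ₂ t, S t), (Λ₁ t, 0, 0, Λ₁ t + Λ₂ t, 0, S t, 0)) with hdd
  have htail : ‖d.2.2.2.2.2.2‖ ≤ C / N :=
    (norm_snd_le d.2.2.2.2.2).trans ((norm_snd_le d.2.2.2.2).trans ((norm_snd_le d.2.2.2).trans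
      ((norm_snd_le d.2.2).trans ((norm_snd_le d.2).trans ((norm_snd_le d).trans key)))))
  refine ⟨(norm_fst_le d.2.2.2.2.2.2).trans htail, ?_⟩
  have := (norm_snd_le d.2.2.2.2.2.2).trans htail
  simpa [hdd] using this

end Systems

/-- O(1/N) closeness of S^N to Š₁^N + Š₂^N. -/
theorem checkS_sum_close {n n₁ : ℕ} (p : Params n n₁) (hp : p.Standing)
    (Λ₁ Λ₂ : ℝ → Matrix (Fin n) (Fin n) ℝ)
    (S : ℝ → Matrix (Fin n) (Fin 1) ℝ) (r : ℝ → ℝ)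
    (hLim : p.IsSolLim Λ₁ Λ₂) (hSr : p.IsSolSr Λ₁ Λ₂ S r) :
    ∃ N₁ : ℕ, 1 ≤ N₁ ∧ ∃ C : ℝ, 0 < C ∧
      ∀ N : ℕ, N₁ ≤ N →
        ∀ (L1 L2 L12 L22 : ℝ → Matrix (Fin n) (Fin n) ℝ)
          (S1 S2 : ℝ → Matrix (Fin n) (Fin 1) ℝ)
          (Λ₁N Λ₂N : ℝ → Matrix (Fin n) (Fin n) ℝ)
          (SN : ℝ → Matrix (Fin n) (Fin 1) ℝ) (rN : ℝ → ℝ),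
          p.IsSolCheckC N Λ₁ Λ₂ S L1 L2 L12 L22 S1 S2 →
          p.IsSolLamN N Λ₁N Λ₂N →
          p.IsSolSrN N Λ₁N Λ₂N SN rN →
          ∀ t ∈ Icc (0 : ℝ) p.T, frob (SN t - S1 t - S2 t) ≤ C / (N : ℝ) := by
  obtain ⟨N₁, hN₁, C₁, hC₁, h₁⟩ := rescaled_close p Λ₁ Λ₂ S r hLim hSr
  obtain ⟨N₂, -, C₂, hC₂, h₂⟩ := check_close p hp Λ₁ Λ₂ S r hLim hSr
  have hn : (0 : ℝ) < (n : ℝ) * (1 : ℕ) := by exact_mod_cast Nat.mul_pos hp.1 one_pos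
  refine ⟨max N₁ N₂, hN₁.trans (le_max_left _ _), (n : ℝ) * (1 : ℕ) * (C₁ + C₂ + C₂),
    by positivity, ?_⟩
  intro N hN L1 L2 L12 L22 S1 S2 Λ₁N Λ₂N SN rN hcheck hLam hSrN t ht
  have b₁ := h₁ N ((le_max_left _ _).trans hN) Λ₁N Λ₂N SN rN hLam hSrN t ht
  obtain ⟨b₂, b₃⟩ := h₂ N ((le_max_right _ _).trans hN) L1 L2 L12 L22 S1 S2 hcheck t ht
  let _ : NormedAddCommGroup (Matrix (Fin n) (Fin 1) ℝ) := Matrix.normedAddCommGroup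
  have e : SN t - S1 t - S2 t = (SN t - S t) - (S1 t - S t) - S2 t := by abel
  refine (frob_le_card_mul_norm _).trans ?_
  rw [mul_div_assoc]
  refine mul_le_mul_of_nonneg_left ?_ hn.le
  rw [e, add_div, add_div]
  exact (norm_sub_le _ _).trans (add_le_add ((norm_sub_le _ _).trans (add_le_add b₁ b₂)) b₃)

end LQ
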